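/- Let q ≥ 4 be an integer and ε ∈ (0, 1/2]. For 0 < r < 1 define δ_LP2(r) as the minimum of 2(a(1−a) − b(1−b))/(1 + 2√(b(1−b))) over all reals 0 ≤ b ≤ a ≤ 1/2 satisfying h₂(a) − h₂(b) ≥ 1 − r. Then for every rate R with log₂(q/2) < R < log₂ q, the reliability function of the typewriter channel satisfies E(R) ≤ δ_LP2(R − log₂(q/2)) · log₂(1/α_ε). -/

import Mathlib

/-- The typewriter channel transition probabilities on `ZMod q`. -/
noncomputable def W (q : ℕ) (ε : ℝ) (y x : ZMod q) : ℝ :=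
  if y = x then 1 - ε else if y = x + 1 then ε else 0

/-- `α_ε = √(ε(1-ε))`. -/
noncomputable def alphaE (ε : ℝ) : ℝ := Real.sqrt (ε * (1 - ε))

/-- The `n`-fold memoryless extension `Wⁿ(y|x) = ∏ₖ W(yₖ|xₖ)`. -/
noncomputable def Wn (q : ℕ) [NeZero q] (n : ℕ) (ε : ℝ) (y x : Fin n → ZMod q) : ℝ :=
  ∏ k, W q ε (y k) (x k)

/-- `Pe(M,n)`: the smallest average error probability over all encoders
`f : Fin M → (ZMod q)ⁿ` and decoders `φ : (ZMod q)ⁿ → Fin M`. -/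
noncomputable def Pe (q : ℕ) [NeZero q] (ε : ℝ) (M n : ℕ) : ℝ :=
  sInf {p : ℝ | ∃ f : Fin M → (Fin n → ZMod q), ∃ φ : (Fin n → ZMod q) → Fin M,
    p = (1 / M) * ∑ m : Fin M, ∑ y : Fin n → ZMod q,
      if φ y = m then 0 else Wn q n ε y (f m)}

/-- The reliability function
`E(R) = limsup_{n→∞} (1/n) log₂ (1 / Pe(⌈2^{nR}⌉, n))`. -/
noncomputable def EReliability (q : ℕ) [NeZero q] (ε : ℝ) (R : ℝ) : ℝ :=
  Filter.limsup (fun n : ℕ =>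
    (1 / (n : ℝ)) * Real.logb 2 (1 / Pe q ε (⌈(2 : ℝ) ^ ((n : ℝ) * R)⌉₊) n))
    Filter.atTop

/-- Binary entropy function (base 2), extended by `log 0 = 0`. -/
noncomputable def h2 (x : ℝ) : ℝ := -(x * Real.logb 2 x) - (1 - x) * Real.logb 2 (1 - x)

/-- The second MRRW linear-programming exponent-distance bound `δ_LP2(r)`:
the minimum of `2(a(1-a) - b(1-b))/(1 + 2√(b(1-b)))` over `0 ≤ b ≤ a ≤ 1/2`
with `h₂(a) - h₂(b) ≥ 1 - r`. -/
noncomputable def deltaLP2 (r : ℝ) : ℝ :=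
  sInf {d : ℝ | ∃ a b : ℝ, 0 ≤ b ∧ b ≤ a ∧ a ≤ 1 / 2 ∧ 1 - r ≤ h2 a - h2 b ∧
    d = 2 * (a * (1 - a) - b * (1 - b)) / (1 + 2 * Real.sqrt (b * (1 - b)))}

/-- The functional `g ↦ ∑ⱼ (-1)ʲ C(i,j) [p]_{i-j} [r]_{i-j} [u]_j [v]_j g(j)`, where `[·]_m` is the
falling factorial, defined by its Pascal-type recursion. At `g = 1` it is a Hahn polynomial. -/
noncomputable def hahnFunctional (p r u v : ℝ) : ℕ → (ℕ → ℝ) → ℝ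
  | 0, g => g 0
  | i + 1, g => hahnFunctional p r u v i
      fun j => (p - i + j) * (r - i + j) * g j - (u - j) * (v - j) * g (j + 1)

lemma hahnFunctional_linear (p r u v : ℝ) (i : ℕ) (a b : ℝ) (g h : ℕ → ℝ) :
    hahnFunctional p r u v i (fun j => a * g j + b * h j) =
      a * hahnFunctional p r u v i g + b * hahnFunctional p r u v i h := by
  induction i generalizing g h with
  | zero => rfl
  | succ i ih =>
    simp only [hahnFunctional]
    rw [← ih]
    congr 1
    funext j
    ring

/-- Removing the first pair instead of the last one. -/
lemma hahnFunctional_succ_eq (p r u v : ℝ) (i : ℕ) (g : ℕ → ℝ) :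
    hahnFunctional p r u v (i + 1) g =
      p * r * hahnFunctional (p - 1) (r - 1) u v i g
        - u * v * hahnFunctional p r (u - 1) (v - 1) i (fun j => g (j + 1)) := by
  induction i generalizing g with
  | zero => simp [hahnFunctional]
  | succ i ih =>
    rw [hahnFunctional, ih]
    simp only [hahnFunctional]
    congr 3 <;> (funext j; push_cast; ring)

lemma hahnFunctional_index_mul (p r u v : ℝ) (i : ℕ) (g : ℕ → ℝ) :
    hahnFunctional p r u v (i + 1) (fun j => j * g j) =
      -((i : ℝ) + 1) * hahnFunctional p r u v i (fun j => (u - j) * (v - j) * g (j + 1)) := by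
  induction i generalizing g with
  | zero => simp [hahnFunctional]
  | succ i ih =>
    have key : (fun j : ℕ => (p - ((i + 1 : ℕ) : ℝ) + j) * (r - ((i + 1 : ℕ) : ℝ) + j) * (j * g j)
          - (u - j) * (v - j) * (((j + 1 : ℕ) : ℝ) * g (j + 1))) =
        fun j : ℕ => 1 * (j * ((p - ((i + 1 : ℕ) : ℝ) + j) * (r - ((i + 1 : ℕ) : ℝ) + j) * g j
          - (u - j) * (v - j) * g (j + 1))) + (-1) * ((u - j) * (v - j) * g (j + 1)) := by
      funext j; push_cast; ring
    rw [hahnFunctional, key, hahnFunctional_linear, ih]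
    simp only [hahnFunctional]
    have key2 : (fun j : ℕ => (u - j) * (v - j) * ((p - ((i + 1 : ℕ) : ℝ) + ((j + 1 : ℕ) : ℝ)) *
          (r - ((i + 1 : ℕ) : ℝ) + ((j + 1 : ℕ) : ℝ)) * g (j + 1)
          - (u - ((j + 1 : ℕ) : ℝ)) * (v - ((j + 1 : ℕ) : ℝ)) * g (j + 1 + 1))) =
        fun j : ℕ => (p - i + j) * (r - i + j) * ((u - j) * (v - j) * g (j + 1)) -
          (u - j) * (v - j) * ((u - ((j + 1 : ℕ) : ℝ)) * (v - ((j + 1 : ℕ) : ℝ)) * g (j + 1 + 1)) := by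
      funext j; push_cast; ring
    rw [key2]
    push_cast
    ring

/-- The Hahn polynomial of the Johnson scheme `J(n,w)` at half-distance `d`. -/
noncomputable def hahnPoly (n w d : ℝ) (i : ℕ) : ℝ :=
  hahnFunctional (w - d) (n - w - d) d d i (fun _ => 1)

noncomputable def hahnKappa (n w : ℝ) (i : ℕ) : ℝ := (w - i) * (n - w - i)

noncomputable def hahnUp (n : ℝ) (i : ℕ) : ℝ := (n - i + 1) / ((n - 2 * i + 1) * (n - 2 * i))

noncomputable def hahnDiag (n w : ℝ) (i : ℕ) : ℝ :=
  (n - i + 1) * hahnKappa n w i / ((n - 2 * i + 1) * (n - 2 * i)) +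
    i * hahnKappa n w (i - 1) / ((n - 2 * i + 1) * (n - 2 * i + 2))

noncomputable def hahnDown (n w : ℝ) (i : ℕ) : ℝ :=
  i * hahnKappa n w (i - 1) ^ 2 / ((n - 2 * i + 1) * (n - 2 * i + 2))

/-- Three-term recurrence of the Hahn polynomials. -/
lemma hahnPoly_recurrence (n w d : ℝ) (i : ℕ) (hi : 2 * (i : ℝ) < n) :
    d * hahnPoly n w d i = -hahnUp n i * hahnPoly n w d (i + 1) + hahnDiag n w i * hahnPoly n w d i
      - hahnDown n w i * hahnPoly n w d (i - 1) := by
  set L := hahnFunctional (w - d) (n - w - d) d d with hL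
  have lin := hahnFunctional_linear (w - d) (n - w - d) d d
  rw [← hL] at lin
  have two : ∀ i : ℕ, hahnPoly n w d (i + 1) =
      hahnKappa n w i * hahnPoly n w d i - (n - 2 * i) * L i (fun j => d - j) := by
    intro i
    have := lin i (hahnKappa n w i) (-(n - 2 * i)) (fun _ => 1) (fun j => d - j)
    simp only [hahnPoly, ← hL]
    rw [sub_eq_add_neg, ← neg_mul, ← this]
    simp only [hL, hahnFunctional, hahnKappa]
    congr 1; funext j; ring
  have three : ∀ i : ℕ, L (i + 1) (fun j => d - j) =
      hahnKappa n w i * L i (fun j => d - j) - (n - 2 * i - 1) * L i (fun j => (d - j) * (d - j)) := by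
    intro i
    have := lin i (hahnKappa n w i) (-(n - 2 * i - 1)) (fun j => d - j) (fun j => (d - j) * (d - j))
    rw [sub_eq_add_neg, ← neg_mul, ← this]
    simp only [hL, hahnFunctional, hahnKappa]
    congr 1; funext j; push_cast; ring
  have one : ∀ i : ℕ, L (i + 1) (fun j => d - j) =
      d * hahnPoly n w d (i + 1) + (i + 1) * L i (fun j => (d - j) * (d - j)) := by
    intro i
    have h1 := lin (i + 1) d (-1) (fun _ => 1) (fun j => j * 1)
    have h2 := hahnFunctional_index_mul (w - d) (n - w - d) d d i (fun _ => 1)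
    rw [← hL] at h2
    rw [h2] at h1
    simp only [mul_one] at h1
    simp only [hahnPoly, ← hL]
    convert h1 using 1
    · congr 1; funext j; ring
    · ring
  rcases i with _ | i
  · have h0 := two 0
    have hn : n ≠ 0 := by simp at hi; exact hi.ne'
    have hn1 : n + 1 ≠ 0 := by simp at hi; positivity
    have h00 : L 0 (fun j => d - j) = d := by simp [hL, hahnFunctional]
    have h01 : hahnPoly n w d 0 = 1 := by simp [hahnPoly, hahnFunctional]
    rw [h00, h01] at h0
    simp only [hahnUp, hahnDiag, hahnDown, h0, h01]
    push_cast
    simp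
    field_simp
    ring
  · push_cast at hi
    have e1 := two i
    have e2 := two (i + 1)
    have e3 := three i
    have e4 := one i
    simp only [Nat.add_sub_cancel, hahnUp, hahnDiag, hahnDown]
    set q0 := hahnPoly n w d i
    set q1 := hahnPoly n w d (i + 1)
    set q2 := hahnPoly n w d (i + 1 + 1)
    set m0 := L i (fun j => d - j)
    set m1 := L (i + 1) (fun j => d - j)
    set t0 := L i (fun j => (d - j) * (d - j))
    set k0 := hahnKappa n w i
    set k1 := hahnKappa n w (i + 1)
    push_cast at e2 ⊢
    have hp0 : n - 2 * (i + 1) ≠ 0 := by linarith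
    have hp1 : n - 2 * ((i : ℝ) + 1) + 1 ≠ 0 := by linarith
    have hp2 : n - 2 * ((i : ℝ) + 1) + 2 ≠ 0 := by linarith
    have f0 : m0 = (k0 * q0 - q1) / (n - 2 * ((i : ℝ) + 1) + 2) := by
      field_simp; linarith
    have f1 : m1 = (k1 * q1 - q2) / (n - 2 * ((i : ℝ) + 1)) := by
      field_simp; linarith
    have f2 : t0 = (k0 * m0 - m1) / (n - 2 * ((i : ℝ) + 1) + 1) := by
      field_simp; linarith
    have f3 : d * q1 = m1 - (i + 1) * t0 := by linarith
    rw [f3, f2, f1, f0]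
    field_simp
    ring

/-- The sum of `∏ (f aₗ - f bₗ)(g aₗ - g bₗ)` over sequences of `i` disjoint pairs in `U`. -/
noncomputable def matchingSum {α : Type*} [DecidableEq α] (f g : α → ℝ) : ℕ → Finset α → ℝ
  | 0, _ => 1
  | i + 1, U => ∑ a ∈ U, ∑ b ∈ U,
      (f a - f b) * (g a - g b) * matchingSum f g i ((U.erase a).erase b)

lemma sum_comp_eq_sum_count_mul {α β : Type*} [Fintype β] [DecidableEq β] (U : Finset α)
    (τ : α → β) (h : β → ℝ) :
    ∑ a ∈ U, h (τ a) = ∑ s, (∑ a ∈ U, if τ a = s then (1 : ℝ) else 0) * h s := by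
  simp_rw [Finset.sum_mul]
  rw [Finset.sum_comm]
  refine Finset.sum_congr rfl fun a _ => ?_
  simp

/-- On `0/1`-valued functions the matching sum is a Hahn functional of the joint type. -/
lemma matchingSum_indicator {α : Type*} [DecidableEq α] (τ : α → Bool × Bool) (i : ℕ)
    (U : Finset α) :
    matchingSum (fun a => if (τ a).1 then 1 else 0) (fun a => if (τ a).2 then 1 else 0) i U =
      2 ^ i * hahnFunctional (∑ a ∈ U, if τ a = (true, true) then (1 : ℝ) else 0)
        (∑ a ∈ U, if τ a = (false, false) then (1 : ℝ) else 0)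
        (∑ a ∈ U, if τ a = (true, false) then (1 : ℝ) else 0)
        (∑ a ∈ U, if τ a = (false, true) then (1 : ℝ) else 0) i (fun _ => 1) := by
  induction i generalizing U with
  | zero => simp [matchingSum, hahnFunctional]
  | succ i ih =>
    let N : Bool × Bool → ℝ := fun z => ∑ a ∈ U, if τ a = z then (1 : ℝ) else 0
    let e : Bool × Bool → Bool × Bool → ℝ := fun s z => if s = z then 1 else 0
    let c : Bool → ℝ := fun b => if b then 1 else 0
    let H : Bool × Bool → Bool × Bool → ℝ := fun s t =>
      (c s.1 - c t.1) * (c s.2 - c t.2) * (2 ^ i * hahnFunctional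
        (N (true, true) - e s (true, true) - e t (true, true))
        (N (false, false) - e s (false, false) - e t (false, false))
        (N (true, false) - e s (true, false) - e t (true, false))
        (N (false, true) - e s (false, true) - e t (false, true)) i (fun _ => 1))
    have step : ∀ a ∈ U, ∀ b ∈ U,
        ((if (τ a).1 then (1 : ℝ) else 0) - (if (τ b).1 then 1 else 0)) *
          ((if (τ a).2 then (1 : ℝ) else 0) - (if (τ b).2 then 1 else 0)) *
          matchingSum (fun a => if (τ a).1 then 1 else 0) (fun a => if (τ a).2 then 1 else 0) i
            ((U.erase a).erase b) = H (τ a) (τ b) := by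
      intro a ha b hb
      by_cases hab : a = b
      · subst hab; simp [H]
      have hb' : b ∈ U.erase a := Finset.mem_erase.2 ⟨Ne.symm hab, hb⟩
      have hN : ∀ z, (∑ x ∈ (U.erase a).erase b, if τ x = z then (1 : ℝ) else 0) =
          N z - e (τ a) z - e (τ b) z := by
        intro z
        rw [Finset.sum_erase_eq_sub hb', Finset.sum_erase_eq_sub ha]
      rw [ih, hN, hN, hN, hN]
    rw [matchingSum, Finset.sum_congr rfl fun a ha => Finset.sum_congr rfl fun b hb => step a ha b hb]
    rw [Finset.sum_congr rfl fun a _ => sum_comp_eq_sum_count_mul U τ (H (τ a))]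
    rw [sum_comp_eq_sum_count_mul U τ (fun s => ∑ t, (∑ a ∈ U, if τ a = t then (1 : ℝ) else 0) * H s t)]
    rw [hahnFunctional_succ_eq]
    change ∑ s, N s * ∑ t, N t * H s t = 2 ^ (i + 1) *
      (N (true, true) * N (false, false) * hahnFunctional (N (true, true) - 1)
        (N (false, false) - 1) (N (true, false)) (N (false, true)) i (fun _ => 1) -
       N (true, false) * N (false, true) * hahnFunctional (N (true, true))
        (N (false, false)) (N (true, false) - 1) (N (false, true) - 1) i (fun _ => 1))
    simp [Fintype.sum_prod_type, H, e, c]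
    ring

section Kernel

open scoped Matrix

variable {ι : Type*} {n : ℕ}

/-- The positive semidefinite kernel attached to matchings of length `i` inside `U`. -/
noncomputable def matchingKernel (S : ι → Finset (Fin n)) (i : ℕ) (U : Finset (Fin n)) :
    Matrix ι ι ℝ :=
  Matrix.of fun x y => matchingSum (fun a => if a ∈ S x then 1 else 0)
    (fun a => if a ∈ S y then 1 else 0) i U

lemma matchingKernel_succ (S : ι → Finset (Fin n)) (i : ℕ) (U : Finset (Fin n)) :
    matchingKernel S (i + 1) U = ∑ a ∈ U, ∑ b ∈ U,
      Matrix.vecMulVec (fun x => (if a ∈ S x then (1 : ℝ) else 0) - if b ∈ S x then 1 else 0)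
        (star fun x => (if a ∈ S x then (1 : ℝ) else 0) - if b ∈ S x then 1 else 0) ⊙
        matchingKernel S i ((U.erase a).erase b) := by
  ext x y
  simp [matchingKernel, matchingSum, Matrix.sum_apply, Matrix.vecMulVec_apply]

lemma matchingKernel_posSemidef [Finite ι] (S : ι → Finset (Fin n)) (i : ℕ) (U : Finset (Fin n)) :
    (matchingKernel S i U).PosSemidef := by
  induction i generalizing U with
  | zero =>
    have : matchingKernel S 0 U = Matrix.vecMulVec (fun _ => (1 : ℝ)) (star fun _ => (1 : ℝ)) := by
      ext x y
      simp [matchingKernel, matchingSum, Matrix.vecMulVec_apply]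
    rw [this]
    exact Matrix.posSemidef_vecMulVec_self_star _
  | succ i ih =>
    rw [matchingKernel_succ]
    exact Matrix.posSemidef_sum _ fun a _ => Matrix.posSemidef_sum _ fun b _ =>
      (Matrix.posSemidef_vecMulVec_self_star _).hadamard (ih _)

/-- Functions on the code that are polynomials of degree at most `k` in the coordinates. -/
noncomputable def polySpace (S : ι → Finset (Fin n)) (k : ℕ) : Submodule ℝ (ι → ℝ) :=
  Submodule.span ℝ (Set.range fun T : {T : Finset (Fin n) // T.card ≤ k} =>
    fun x => if T.1 ⊆ S x then (1 : ℝ) else 0)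

lemma polySpace_mono (S : ι → Finset (Fin n)) : Monotone (polySpace S) := by
  intro k l hkl
  refine Submodule.span_mono ?_
  rintro _ ⟨T, rfl⟩
  exact ⟨⟨T.1, T.2.trans hkl⟩, rfl⟩

lemma indicator_mul_mem_polySpace (S : ι → Finset (Fin n)) (k : ℕ) (a : Fin n) (f : ι → ℝ)
    (hf : f ∈ polySpace S k) :
    (fun x => (if a ∈ S x then (1 : ℝ) else 0) * f x) ∈ polySpace S (k + 1) := by
  induction hf using Submodule.span_induction with
  | mem f hf =>
    obtain ⟨T, rfl⟩ := hf
    refine Submodule.subset_span ⟨⟨insert a T.1, (Finset.card_insert_le _ _).trans ?_⟩, ?_⟩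
    · exact Nat.succ_le_succ T.2
    · funext x
      by_cases h1 : a ∈ S x <;> by_cases h2 : T.1 ⊆ S x <;> simp [Finset.insert_subset_iff, h1, h2]
  | zero =>
    convert (polySpace S (k + 1)).zero_mem using 1
    funext x; simp
  | add f g _ _ h1 h2 =>
    have := Submodule.add_mem _ h1 h2
    convert this using 1
    funext x; simp [mul_add]
  | smul c f _ h =>
    have := Submodule.smul_mem _ c h
    convert this using 1
    funext x; simp

lemma matchingKernel_col_mem (S : ι → Finset (Fin n)) (i : ℕ) (U : Finset (Fin n)) (y : ι) :
    (fun x => matchingKernel S i U x y) ∈ polySpace S i := by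
  induction i generalizing U with
  | zero =>
    refine Submodule.subset_span ⟨⟨∅, by simp⟩, ?_⟩
    funext x
    simp [matchingKernel, matchingSum]
  | succ i ih =>
    have : (fun x => matchingKernel S (i + 1) U x y) = ∑ a ∈ U, ∑ b ∈ U,
        ((if a ∈ S y then (1 : ℝ) else 0) - if b ∈ S y then 1 else 0) •
        ((fun x => (if a ∈ S x then (1 : ℝ) else 0) *
            matchingKernel S i ((U.erase a).erase b) x y) -
          fun x => (if b ∈ S x then (1 : ℝ) else 0) *
            matchingKernel S i ((U.erase a).erase b) x y) := by
      funext x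
      simp only [matchingKernel_succ, Matrix.sum_apply, Matrix.hadamard_apply,
        Matrix.vecMulVec_apply, Finset.sum_apply, Pi.smul_apply, Pi.sub_apply, smul_eq_mul,
        star_trivial]
      refine Finset.sum_congr rfl fun a _ => Finset.sum_congr rfl fun b _ => ?_
      ring
    rw [this]
    refine Submodule.sum_mem _ fun a _ => Submodule.sum_mem _ fun b _ => Submodule.smul_mem _ _ ?_
    exact Submodule.sub_mem _ (indicator_mul_mem_polySpace S i a _ (ih _))
      (indicator_mul_mem_polySpace S i b _ (ih _))

variable [Fintype ι]

lemma rank_le_of_col_mem_polySpace (S : ι → Finset (Fin n)) (k : ℕ) (A : Matrix ι ι ℝ)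
    (hA : ∀ y, (fun x => A x y) ∈ polySpace S k) :
    A.rank ≤ Fintype.card {T : Finset (Fin n) // T.card ≤ k} := by
  rw [Matrix.rank_eq_finrank_span_cols]
  refine (Submodule.finrank_mono (t := polySpace S k) ?_).trans (finrank_range_le_card _)
  rw [Submodule.span_le]
  rintro _ ⟨y, rfl⟩
  exact hA y

lemma trace_sq_le_rank_mul {A : Matrix ι ι ℝ} (hA : A.IsHermitian) :
    A.trace ^ 2 ≤ A.rank * ∑ x, ∑ y, A x y ^ 2 := by
  classical
  have h2 : ∑ x, ∑ y, A x y ^ 2 = ∑ i, hA.eigenvalues i ^ 2 := by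
    have e1 : ∑ x, ∑ y, A x y ^ 2 = (A * A).trace := by
      simp only [Matrix.trace, Matrix.diag, Matrix.mul_apply]
      refine Finset.sum_congr rfl fun x _ => Finset.sum_congr rfl fun y _ => ?_
      have := hA.apply x y
      simp only [star_trivial] at this
      rw [this]; ring
    rw [e1]
    conv_lhs => rw [hA.spectral_theorem, ← map_mul, Unitary.conjStarAlgAut_apply]
    rw [Matrix.trace_mul_cycle, Unitary.coe_star_mul_self, Matrix.one_mul,
      Matrix.diagonal_mul_diagonal, Matrix.trace_diagonal]
    simp [sq]
  have h1 : A.trace = ∑ i ∈ Finset.univ.filter (fun i => hA.eigenvalues i ≠ 0), hA.eigenvalues i := by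
    rw [hA.trace_eq_sum_eigenvalues, Finset.sum_filter_ne_zero]
    rfl
  rw [h1, h2, hA.rank_eq_card_non_zero_eigs, Fintype.card_subtype]
  refine sq_sum_le_card_mul_sum_sq.trans ?_
  gcongr
  exact Finset.filter_subset _ _

end Kernel

lemma hahnPoly_zero_pos (n w : ℝ) (i : ℕ) (h1 : (i : ℝ) ≤ w) (h2 : (i : ℝ) ≤ n - w) :
    0 < hahnPoly n w 0 i := by
  simp only [hahnPoly, sub_zero]
  induction i generalizing n w with
  | zero => simp [hahnFunctional]
  | succ i ih =>
    push_cast at h1 h2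
    have hi : (0 : ℝ) ≤ i := Nat.cast_nonneg i
    rw [hahnFunctional_succ_eq]
    have := ih (n - 2) (w - 1) (by linarith) (by linarith)
    rw [show n - 2 - (w - 1) = n - w - 1 by ring] at this
    have hw : 0 < w := by linarith
    have hnw : 0 < n - w := by linarith
    simp only [zero_mul, sub_zero]
    positivity

lemma matchingKernel_univ_apply {ι : Type*} {n w : ℕ} (S : ι → Finset (Fin n))
    (hS : ∀ x, (S x).card = w) (i : ℕ) (x y : ι) :
    matchingKernel S i Finset.univ x y = 2 ^ i * hahnPoly n w ((S x \ S y).card) i := by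
  have h := matchingSum_indicator (fun a : Fin n => (decide (a ∈ S x), decide (a ∈ S y))) i
    Finset.univ
  simp only [decide_eq_true_eq] at h
  have h11 : (S x ∩ S y).card + (S x \ S y).card = w := by
    rw [Finset.card_inter_add_card_sdiff, hS]
  have h10 : (S y \ S x).card = (S x \ S y).card := by
    have := Finset.card_inter_add_card_sdiff (S y) (S x)
    rw [Finset.inter_comm, hS] at this
    omega
  have h00 : ((S x ∪ S y)ᶜ).card + (w + (S x \ S y).card) = n := by
    have e1 := Finset.card_union_add_card_inter (S x) (S y)
    have e2 := Finset.card_compl_add_card (S x ∪ S y)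
    rw [Fintype.card_fin] at e2
    rw [hS, hS] at e1
    omega
  have c1 : (∑ a : Fin n, if (decide (a ∈ S x), decide (a ∈ S y)) = (true, true)
      then (1 : ℝ) else 0) = w - (S x \ S y).card := by
    rw [Finset.sum_boole, eq_sub_iff_add_eq]
    norm_cast
    rw [← h11]
    congr 2
    ext a; simp
  have c2 : (∑ a : Fin n, if (decide (a ∈ S x), decide (a ∈ S y)) = (false, false)
      then (1 : ℝ) else 0) = n - w - (S x \ S y).card := by
    rw [Finset.sum_boole, sub_sub, eq_sub_iff_add_eq]
    norm_cast
    refine Eq.trans ?_ h00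
    congr 2
    ext a; simp
  have c3 : (∑ a : Fin n, if (decide (a ∈ S x), decide (a ∈ S y)) = (true, false)
      then (1 : ℝ) else 0) = (S x \ S y).card := by
    rw [Finset.sum_boole]
    congr 2
    ext a; simp
  have c4 : (∑ a : Fin n, if (decide (a ∈ S x), decide (a ∈ S y)) = (false, true)
      then (1 : ℝ) else 0) = (S x \ S y).card := by
    rw [Finset.sum_boole, ← h10]
    congr 2
    ext a; simp [and_comm]
  rw [c1, c2, c3, c4] at h
  exact h

open scoped Matrix in
/-- Linear programming bound for constant weight codes, with an explicit test function
`∑ bᵢ qᵢ` in the Hahn basis. -/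
theorem card_mul_le_of_constantWeight {ι : Type*} [Fintype ι] [Nonempty ι] {n w : ℕ}
    (S : ι → Finset (Fin n)) (hS : ∀ x, (S x).card = w) (k : ℕ) (hk : 2 * (k : ℝ) < n)
    (hkw : k ≤ w) (hkw' : k + w ≤ n) (b : ℕ → ℝ) (hb : ∀ i, 0 ≤ b i) (hbk : 0 < b k)
    (hbz : ∀ i, k < i → b i = 0) (μ τ : ℝ) (hτ : 0 < τ)
    (he : ∀ j ≤ k, hahnDiag n w j * b j ≤ μ * b j +
      (if j = 0 then 0 else hahnUp n (j - 1) * b (j - 1)) + hahnDown n w (j + 1) * b (j + 1))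
    (hd : ∀ x y, x ≠ y → μ + τ ≤ (S x \ S y).card) :
    Fintype.card ι * τ ≤ Fintype.card {T : Finset (Fin n) // T.card ≤ k} * (μ + τ) := by
  classical
  let Q : ℕ → Matrix ι ι ℝ := fun i => ((2 : ℝ) ^ i)⁻¹ • matchingKernel S i Finset.univ
  have hQ : ∀ i x y, Q i x y = hahnPoly n w ((S x \ S y).card) i := by
    intro i x y
    simp only [Q, Matrix.smul_apply, smul_eq_mul]
    rw [matchingKernel_univ_apply S hS]
    field_simp
  have hQpsd : ∀ i, (Q i).PosSemidef := fun i =>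
    (matchingKernel_posSemidef S i _).smul (by positivity)
  let f : Matrix ι ι ℝ := ∑ i ∈ Finset.range (k + 1), b i • Q i
  have hfpsd : f.PosSemidef := Matrix.posSemidef_sum _ fun i _ => (hQpsd i).smul (hb i)
  let e : ℕ → ℝ := fun j => μ * b j - hahnDiag n w j * b j +
      (if j = 0 then 0 else hahnUp n (j - 1) * b (j - 1)) + hahnDown n w (j + 1) * b (j + 1)
  have hepos : ∀ j ∈ Finset.range (k + 2), 0 ≤ e j := by
    intro j hj
    rw [Finset.mem_range] at hj
    rcases Nat.lt_or_ge k j with hjk | hjk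
    · obtain rfl : j = k + 1 := by omega
      have h1 := hbz (k + 1) (by omega)
      have h2 := hbz (k + 1 + 1) (by omega)
      simp only [e, h1, h2]
      simp only [mul_zero, sub_zero, zero_add, add_zero, Nat.add_eq_zero_iff, one_ne_zero, and_false,
        if_false, Nat.add_sub_cancel]
      refine mul_nonneg ?_ hbk.le
      have hk0 : (0 : ℝ) ≤ k := Nat.cast_nonneg k
      exact div_nonneg (by linarith) (mul_nonneg (by linarith) (by linarith))
    · have := he j hjk
      simp only [e]
      linarith
  let g : Matrix ι ι ℝ := ∑ j ∈ Finset.range (k + 2), e j • Q j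
  have hgpsd : g.PosSemidef := Matrix.posSemidef_sum _ fun i hi => (hQpsd i).smul (hepos i hi)
  have hfg : ∀ x y, g x y = (μ - (S x \ S y).card) * f x y := by
    intro x y
    simp only [g, f, Matrix.sum_apply, Matrix.smul_apply, smul_eq_mul, hQ]
    set d : ℝ := ((S x \ S y).card : ℝ)
    set q : ℕ → ℝ := hahnPoly n w d
    have hrec : ∀ i ∈ Finset.range (k + 1), (μ - d) * (b i * q i) =
        (μ * b i - hahnDiag n w i * b i) * q i + hahnUp n i * b i * q (i + 1) +
          hahnDown n w i * b i * q (i - 1) := by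
      intro i hi
      have hik : (i : ℝ) ≤ k := by exact_mod_cast Nat.lt_succ_iff.1 (Finset.mem_range.1 hi)
      have := hahnPoly_recurrence n w d i (by linarith)
      simp only [q]
      linear_combination (-b i) * this
    rw [Finset.mul_sum, Finset.sum_congr rfl hrec, Finset.sum_add_distrib, Finset.sum_add_distrib]
    simp only [e, add_mul, Finset.sum_add_distrib]
    congr 1
    · congr 1
      · rw [Finset.sum_range_succ _ (k + 1), hbz (k + 1) (by omega)]
        simp
      · rw [Finset.sum_range_succ']
        simp
    · rw [Finset.sum_range_succ' _ k, Finset.sum_range_succ _ (k + 1), Finset.sum_range_succ _ k,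
        hbz (k + 1) (by omega), hbz (k + 1 + 1) (by omega)]
      simp [hahnDown]
  let f0 : ℝ := ∑ i ∈ Finset.range (k + 1), b i * hahnPoly n w 0 i
  have hf0 : 0 < f0 := by
    have hpos : ∀ i ∈ Finset.range (k + 1), 0 < hahnPoly n w 0 i := by
      intro i hi
      have hi' := Nat.lt_succ_iff.1 (Finset.mem_range.1 hi)
      refine hahnPoly_zero_pos _ _ _ (by exact_mod_cast hi'.trans hkw) ?_
      rw [le_sub_iff_add_le]
      exact_mod_cast (by omega : i + w ≤ n)
    refine Finset.sum_pos' (fun i hi => mul_nonneg (hb i) (hpos i hi).le) ⟨k, by simp, ?_⟩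
    exact mul_pos hbk (hpos k (by simp))
  have hdiag : ∀ x, f x x = f0 := by
    intro x
    simp [f, f0, Matrix.sum_apply, hQ]
  have hrank : (f.rank : ℝ) ≤ Fintype.card {T : Finset (Fin n) // T.card ≤ k} := by
    have := rank_le_of_col_mem_polySpace S k f fun y => by
      have : (fun x => f x y) = ∑ i ∈ Finset.range (k + 1),
          (b i * ((2 : ℝ) ^ i)⁻¹) • fun x => matchingKernel S i Finset.univ x y := by
        funext x
        simp [f, Q, Matrix.sum_apply, mul_assoc]
      rw [this]
      exact Submodule.sum_mem _ fun i hi => Submodule.smul_mem _ _ <|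
        polySpace_mono S (Nat.lt_succ_iff.1 (Finset.mem_range.1 hi)) (matchingKernel_col_mem S i _ y)
    exact_mod_cast this
  have htr : f.trace = Fintype.card ι * f0 := by
    simp [Matrix.trace, hdiag]
  have hmain : 0 ≤ ∑ x, ∑ y, (μ - (S x \ S y).card) * f x y ^ 2 := by
    have := (hgpsd.hadamard hfpsd).dotProduct_mulVec_nonneg (fun _ => 1)
    simp only [dotProduct, Matrix.mulVec, Matrix.hadamard_apply, hfg, Pi.star_apply, star_trivial,
      one_mul, mul_one] at this
    refine this.trans_eq (Finset.sum_congr rfl fun x _ => Finset.sum_congr rfl fun y _ => ?_)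
    ring
  have hupper : ∑ x, ∑ y, (μ + τ - (S x \ S y).card) * f x y ^ 2 ≤
      Fintype.card ι * ((μ + τ) * f0 ^ 2) := by
    rw [← nsmul_eq_mul, ← Finset.card_univ, ← Finset.sum_const]
    refine Finset.sum_le_sum fun x _ => ?_
    rw [← Finset.add_sum_erase _ _ (Finset.mem_univ x)]
    have : ∑ y ∈ Finset.univ.erase x, (μ + τ - (S x \ S y).card) * f x y ^ 2 ≤ 0 :=
      Finset.sum_nonpos fun y hy => mul_nonpos_of_nonpos_of_nonneg
        (by linarith [hd x y (Finset.ne_of_mem_erase hy).symm]) (sq_nonneg _)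
    simp only [sdiff_self, Finset.bot_eq_empty, Finset.card_empty, Nat.cast_zero, sub_zero, hdiag]
    linarith
  have hsplit : ∑ x, ∑ y, (μ + τ - (S x \ S y).card) * f x y ^ 2 =
      (∑ x, ∑ y, (μ - (S x \ S y).card) * f x y ^ 2) + τ * ∑ x, ∑ y, f x y ^ 2 := by
    simp only [Finset.mul_sum, ← Finset.sum_add_distrib]
    refine Finset.sum_congr rfl fun x _ => Finset.sum_congr rfl fun y _ => ?_
    ring
  have hcs := trace_sq_le_rank_mul hfpsd.isHermitian
  rw [htr] at hcs
  set F := ∑ x, ∑ y, f x y ^ 2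
  set D : ℝ := (Fintype.card {T : Finset (Fin n) // T.card ≤ k} : ℝ)
  have hF : 0 ≤ F := Finset.sum_nonneg fun x _ => Finset.sum_nonneg fun y _ => sq_nonneg _
  have hN : (0 : ℝ) < Fintype.card ι := by exact_mod_cast Fintype.card_pos
  set N : ℝ := (Fintype.card ι : ℝ)
  have h1 : (N * f0) ^ 2 ≤ D * F := hcs.trans (mul_le_mul_of_nonneg_right hrank hF)
  have h2 : τ * F ≤ N * ((μ + τ) * f0 ^ 2) := by linarith
  have hD : 0 ≤ D := Nat.cast_nonneg _
  have h3 : (N * f0 ^ 2) * (N * τ) ≤ (N * f0 ^ 2) * (D * (μ + τ)) := by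
    calc (N * f0 ^ 2) * (N * τ) = τ * (N * f0) ^ 2 := by ring
      _ ≤ τ * (D * F) := by gcongr
      _ = D * (τ * F) := by ring
      _ ≤ D * (N * ((μ + τ) * f0 ^ 2)) := by gcongr
      _ = _ := by ring
  exact le_of_mul_le_mul_left h3 (by positivity)

section Asymptotics

open Filter Topology

lemma tendsto_natSub_div {i : ℕ → ℕ} {b : ℝ} (c : ℕ)
    (hi : Tendsto (fun n => (i n : ℝ) / n) atTop (𝓝 b)) :
    Tendsto (fun n => ((i n - c : ℕ) : ℝ) / n) atTop (𝓝 b) := by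
  have h0 : Tendsto (fun n : ℕ => (i n : ℝ) / n - (c : ℝ) / n) atTop (𝓝 b) := by
    simpa using hi.sub (tendsto_const_div_atTop_nhds_zero_nat (c : ℝ))
  refine tendsto_of_tendsto_of_tendsto_of_le_of_le h0 hi (fun n => ?_) (fun n => ?_)
  · simp only [← sub_div]
    gcongr
    rw [sub_le_iff_le_add]
    exact_mod_cast le_tsub_add
  · simp only
    gcongr
    exact_mod_cast Nat.sub_le _ _

lemma tendsto_natAdd_div {i : ℕ → ℕ} {b : ℝ} (c : ℕ)
    (hi : Tendsto (fun n => (i n : ℝ) / n) atTop (𝓝 b)) :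
    Tendsto (fun n => ((i n + c : ℕ) : ℝ) / n) atTop (𝓝 b) := by
  have := hi.add (tendsto_const_div_atTop_nhds_zero_nat (c : ℝ))
  rw [add_zero] at this
  refine this.congr fun n => ?_
  push_cast
  rw [add_div]

lemma tendsto_hahnKappa {w i : ℕ → ℕ} {a b : ℝ}
    (hw : Tendsto (fun n => (w n : ℝ) / n) atTop (𝓝 a))
    (hi : Tendsto (fun n => (i n : ℝ) / n) atTop (𝓝 b)) :
    Tendsto (fun n : ℕ => hahnKappa n (w n) (i n) / (n : ℝ) ^ 2) atTop
      (𝓝 ((a - b) * (1 - a - b))) := by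
  refine ((hw.sub hi).mul ((tendsto_const_nhds.sub hw).sub hi)).congr' ?_
  filter_upwards [eventually_gt_atTop 0] with n hn
  have : (n : ℝ) ≠ 0 := by positivity
  simp only [hahnKappa]
  field_simp

lemma tendsto_hahnUp {i : ℕ → ℕ} {b : ℝ} (hb : b < 1 / 2)
    (hi : Tendsto (fun n => (i n : ℝ) / n) atTop (𝓝 b)) :
    Tendsto (fun n : ℕ => hahnUp n (i n) * n) atTop (𝓝 ((1 - b) / (1 - 2 * b) ^ 2)) := by
  have h1 := tendsto_const_div_atTop_nhds_zero_nat (1 : ℝ)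
  have hne : (1 - 2 * b + 0) * (1 - 2 * b) ≠ 0 := by
    have : 0 < 1 - 2 * b := by linarith
    rw [add_zero]; positivity
  have key := (((tendsto_const_nhds (x := (1 : ℝ))).sub hi).add h1).div
    ((((tendsto_const_nhds (x := (1 : ℝ))).sub (hi.const_mul 2)).add h1).mul
      ((tendsto_const_nhds (x := (1 : ℝ))).sub (hi.const_mul 2))) hne
  rw [show (1 - b) / (1 - 2 * b) ^ 2 = (1 - b + 0) / ((1 - 2 * b + 0) * (1 - 2 * b)) by ring]
  refine key.congr' ?_
  filter_upwards [eventually_gt_atTop 0] with n hn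
  have : (n : ℝ) ≠ 0 := by positivity
  have e1 : 1 - (i n : ℝ) / n + 1 / n = (n - i n + 1) / n := by field_simp
  have e2 : 1 - 2 * ((i n : ℝ) / n) + 1 / n = (n - 2 * i n + 1) / n := by field_simp
  have e3 : 1 - 2 * ((i n : ℝ) / n) = (n - 2 * i n) / n := by field_simp
  simp only [Pi.div_apply, hahnUp]
  rw [e1, e2, e3, div_mul_div_comm, div_div_div_eq, div_mul_eq_mul_div,
    mul_comm (n : ℝ) ((_ : ℝ) * _), ← mul_assoc, mul_div_mul_right _ _ this]

lemma tendsto_hahnDownFactor {i : ℕ → ℕ} {b : ℝ} (hb : b < 1 / 2)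
    (hi : Tendsto (fun n => (i n : ℝ) / n) atTop (𝓝 b)) :
    Tendsto (fun n : ℕ => (i n : ℝ) / (((n : ℝ) - 2 * i n + 1) * (n - 2 * i n + 2)) * n) atTop
      (𝓝 (b / (1 - 2 * b) ^ 2)) := by
  have h1 := tendsto_const_div_atTop_nhds_zero_nat (1 : ℝ)
  have h2 := tendsto_const_div_atTop_nhds_zero_nat (2 : ℝ)
  have hne : (1 - 2 * b + 0) * (1 - 2 * b + 0) ≠ 0 := by
    have : 0 < 1 - 2 * b := by linarith
    rw [add_zero]; positivity
  have key := hi.div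
    ((((tendsto_const_nhds (x := (1 : ℝ))).sub (hi.const_mul 2)).add h1).mul
      (((tendsto_const_nhds (x := (1 : ℝ))).sub (hi.const_mul 2)).add h2)) hne
  rw [show b / (1 - 2 * b) ^ 2 = b / ((1 - 2 * b + 0) * (1 - 2 * b + 0)) by ring]
  refine key.congr' ?_
  filter_upwards [eventually_gt_atTop 0] with n hn
  have : (n : ℝ) ≠ 0 := by positivity
  have e2 : 1 - 2 * ((i n : ℝ) / n) + 1 / n = (n - 2 * i n + 1) / n := by field_simp
  have e3 : 1 - 2 * ((i n : ℝ) / n) + 2 / n = (n - 2 * i n + 2) / n := by field_simp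
  simp only [Pi.div_apply]
  rw [e2, e3, div_mul_div_comm, div_div_div_eq, div_mul_eq_mul_div,
    mul_comm (n : ℝ) ((_ : ℝ) * _), ← mul_assoc, mul_div_mul_right _ _ this]

lemma tendsto_hahnDiag {w i : ℕ → ℕ} {a b : ℝ} (hb : b < 1 / 2)
    (hw : Tendsto (fun n => (w n : ℝ) / n) atTop (𝓝 a))
    (hi : Tendsto (fun n => (i n : ℝ) / n) atTop (𝓝 b)) :
    Tendsto (fun n : ℕ => hahnDiag n (w n) (i n) / n) atTop
      (𝓝 ((a - b) * (1 - a - b) / (1 - 2 * b) ^ 2)) := by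
  have key := ((tendsto_hahnUp hb hi).mul (tendsto_hahnKappa hw hi)).add
    ((tendsto_hahnDownFactor hb hi).mul (tendsto_hahnKappa hw (tendsto_natSub_div 1 hi)))
  rw [show (a - b) * (1 - a - b) / (1 - 2 * b) ^ 2 = (1 - b) / (1 - 2 * b) ^ 2 *
    ((a - b) * (1 - a - b)) + b / (1 - 2 * b) ^ 2 * ((a - b) * (1 - a - b)) by ring]
  refine key.congr' ?_
  filter_upwards [eventually_gt_atTop 0] with n hn
  have : (n : ℝ) ≠ 0 := by positivity
  simp only [hahnUp, hahnDiag]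
  rw [add_div]
  rw [mul_div_right_comm]; field_simp

lemma tendsto_hahnDown {w i : ℕ → ℕ} {a b : ℝ} (hb : b < 1 / 2)
    (hw : Tendsto (fun n => (w n : ℝ) / n) atTop (𝓝 a))
    (hi : Tendsto (fun n => (i n : ℝ) / n) atTop (𝓝 b)) :
    Tendsto (fun n : ℕ => hahnDown n (w n) (i n) / (n : ℝ) ^ 3) atTop
      (𝓝 (b / (1 - 2 * b) ^ 2 * ((a - b) * (1 - a - b)) ^ 2)) := by
  refine ((tendsto_hahnDownFactor hb hi).mul
    ((tendsto_hahnKappa hw (tendsto_natSub_div 1 hi)).pow 2)).congr' ?_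
  filter_upwards [eventually_gt_atTop 0] with n hn
  have : (n : ℝ) ≠ 0 := by positivity
  simp only [hahnDown]
  rw [mul_div_right_comm]
  field_simp

/-- Asymptotic linear programming bound for constant weight codes. -/
theorem eventually_constantWeight_bound {w k : ℕ → ℕ} {a b M η : ℝ} (hb : 0 < b) (hba : b < a)
    (ha : a ≤ 1 / 2) (hw : Tendsto (fun n => (w n : ℝ) / n) atTop (𝓝 a))
    (hk : Tendsto (fun n => (k n : ℝ) / n) atTop (𝓝 b)) (hη : 0 < η)
    (hM : (a * (1 - a) - b * (1 - b)) / (1 + 2 * √(b * (1 - b))) < M) :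
    ∀ᶠ n : ℕ in atTop, ∀ (ι : Type) [Fintype ι] [Nonempty ι] (S : ι → Finset (Fin n)),
      (∀ x, (S x).card = w n) →
      (∀ x y, x ≠ y → n * (M + η) ≤ ((S x \ S y).card : ℝ)) →
      Fintype.card ι * η ≤ Fintype.card {T : Finset (Fin n) // T.card ≤ k n} * (M + η) := by
  have hb2 : b < 1 / 2 := by linarith
  set κ : ℝ := (a - b) * (1 - a - b) with hκ
  have hκpos : 0 < κ := mul_pos (by linarith) (by linarith)
  set s : ℝ := √(b * (1 - b)) with hs
  have hbb : 0 < b * (1 - b) := mul_pos hb (by linarith)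
  have hspos : 0 < s := Real.sqrt_pos.2 hbb
  have hs2 : s * s = b * (1 - b) := Real.mul_self_sqrt hbb.le
  have h12b : 0 < 1 - 2 * b := by linarith
  set σ : ℝ := κ * s / (1 - 2 * b) ^ 2 with hσ
  have hσpos : 0 < σ := by positivity
  set β : ℝ := κ / (1 - 2 * b) ^ 2 with hβ
  have hMβ : β - 2 * σ < M := by
    refine lt_of_eq_of_lt ?_ hM
    have e : (1 - 2 * b) ^ 2 = (1 - 2 * s) * (1 + 2 * s) := by linear_combination 4 * hs2
    have h1 : 0 < 1 + 2 * s := by positivity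
    have h2 : 1 - 2 * s ≠ 0 := by
      intro h
      rw [h, zero_mul] at e
      exact absurd e (by positivity)
    rw [hβ, hσ, e, hκ]
    field_simp
    ring
  obtain ⟨m, hm⟩ := exists_nat_gt (2 * σ / (M - (β - 2 * σ)))
  have hgap : 0 < M - (β - 2 * σ) := by linarith
  have hm0 : (0 : ℝ) < m := lt_of_le_of_lt (by positivity) hm
  have hm' : 2 * σ < (M - (β - 2 * σ)) * m := by
    rw [div_lt_iff₀ hgap] at hm
    linarith
  let p : ℝ → ℝ := fun x => (x + 1) * (m - x)
  have hpm : ∀ l : ℕ, l < m → (m : ℝ) ≤ p l := by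
    intro l hl
    have h1 : (l : ℝ) + 1 ≤ m := by exact_mod_cast hl
    have h2 : (0 : ℝ) ≤ l := Nat.cast_nonneg l
    simp only [p]
    nlinarith [mul_nonneg h2 (sub_nonneg.2 h1)]
  have hlimit : ∀ l : ℕ, l < m → β * p l < M * p l + σ * p (l + 1) + σ * p (l - 1) := by
    intro l hl
    have h1 := hpm l hl
    have h2 : p (l + 1) + p (l - 1) = 2 * p l - 2 := by simp only [p]; ring
    have h3 : (M - (β - 2 * σ)) * m ≤ (M - (β - 2 * σ)) * p l := by gcongr
    have h4 : σ * p (l + 1) + σ * p (l - 1) = σ * (2 * p l - 2) := by rw [← h2]; ring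
    linarith
  set t : ℝ := κ * s / (1 - b) with ht
  have h1b : 0 < 1 - b := by linarith
  have htpos : 0 < t := by positivity
  have hev : ∀ l : ℕ, l < m → ∀ᶠ n : ℕ in atTop,
      hahnDiag n (w n) (k n - l) / n * p l <
        M * p l + hahnUp n (k n - l - 1) * n * t * p (l + 1) +
          hahnDown n (w n) (k n - l + 1) / (n : ℝ) ^ 3 / t * p (l - 1) := by
    intro l hl
    have hi := tendsto_natSub_div l hk
    have e1 : σ = (1 - b) / (1 - 2 * b) ^ 2 * t := by
      rw [hσ, ht]; field_simp
    have e2 : σ = b / (1 - 2 * b) ^ 2 * κ ^ 2 / t := by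
      rw [hσ, ht]; field_simp
      linear_combination hs2
    have hlim := hlimit l hl
    rw [show M * p l + σ * p (l + 1) + σ * p (l - 1) = M * p l +
      (1 - b) / (1 - 2 * b) ^ 2 * t * p (l + 1) +
      b / (1 - 2 * b) ^ 2 * κ ^ 2 / t * p (l - 1) by rw [← e1, ← e2]] at hlim
    refine Tendsto.eventually_lt ((tendsto_hahnDiag hb2 hw hi).mul_const _)
      ((tendsto_const_nhds.add (((tendsto_hahnUp hb2 (tendsto_natSub_div 1 hi)).mul_const _).mul_const
        _)).add (((tendsto_hahnDown hb2 hw (tendsto_natAdd_div 1 hi)).div_const _).mul_const _)) hlim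
  have hall : ∀ᶠ n : ℕ in atTop, ∀ l ∈ Finset.range m,
      hahnDiag n (w n) (k n - l) / n * p l <
        M * p l + hahnUp n (k n - l - 1) * n * t * p (l + 1) +
          hahnDown n (w n) (k n - l + 1) / (n : ℝ) ^ 3 / t * p (l - 1) :=
    (Finset.eventually_all _).2 fun l hl => hev l (Finset.mem_range.1 hl)
  have hkm : ∀ᶠ n : ℕ in atTop, (m : ℝ) / n < (k n : ℝ) / n :=
    (tendsto_const_div_atTop_nhds_zero_nat (m : ℝ)).eventually_lt hk hb
  have hk2 : ∀ᶠ n : ℕ in atTop, (k n : ℝ) / n < 1 / 2 := hk.eventually_lt_const hb2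
  have hk3 : ∀ᶠ n : ℕ in atTop, ((k n + 1 : ℕ) : ℝ) / n < 1 / 2 :=
    (tendsto_natAdd_div 1 hk).eventually_lt_const hb2
  have hkw : ∀ᶠ n : ℕ in atTop, (k n : ℝ) / n < (w n : ℝ) / n := hk.eventually_lt hw hba
  have hkw' : ∀ᶠ n : ℕ in atTop, (k n : ℝ) / n + (w n : ℝ) / n < 1 :=
    (hk.add hw).eventually_lt_const (by linarith)
  filter_upwards [hall, hkm, hk2, hk3, hkw, hkw', eventually_gt_atTop 0] with
    n hn hkm hk2 hk3 hkw hkw' hn0 ι _ _ S hS hd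
  have hnpos : (0 : ℝ) < n := by exact_mod_cast hn0
  rw [div_lt_div_iff_of_pos_right hnpos] at hkm hkw
  rw [div_lt_iff₀ hnpos] at hk2 hk3
  rw [← add_div, div_lt_one hnpos] at hkw'
  have hkm' : m < k n := by exact_mod_cast hkm
  have hkwN : k n ≤ w n := by exact_mod_cast hkw.le
  have hkwN' : k n + w n ≤ n := by exact_mod_cast hkw'.le
  let θ : ℝ := (n : ℝ) ^ 2 * t
  have hθ : 0 < θ := by positivity
  let c : ℕ → ℝ := fun i => if i ≤ k n ∧ k n < i + m then θ ^ (k n - i) * p ((k n - i : ℕ) : ℝ) else 0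
  have hc : ∀ i, 0 ≤ c i := by
    intro i
    simp only [c]
    split_ifs with h
    · have := hpm (k n - i) (by omega)
      have : 0 ≤ p ((k n - i : ℕ) : ℝ) := hm0.le.trans this
      positivity
    · exact le_rfl
  have hmN : 0 < m := by exact_mod_cast hm0
  have hck : 0 < c (k n) := by
    simp only [c]
    rw [if_pos ⟨le_rfl, by omega⟩]
    have := hpm 0 hmN
    simp only [Nat.sub_self, pow_zero, one_mul]
    exact hm0.trans_le this
  have hcz : ∀ i, k n < i → c i = 0 := by
    intro i hi
    simp only [c]
    rw [if_neg (by omega)]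
  have hupnn : ∀ j ≤ k n, 0 ≤ hahnUp n j := by
    intro j hj
    have : (j : ℝ) ≤ k n := by exact_mod_cast hj
    exact div_nonneg (by linarith) (mul_nonneg (by linarith) (by linarith))
  have hdownnn : ∀ j ≤ k n + 1, 0 ≤ hahnDown n (w n) j := by
    intro j hj
    have : (j : ℝ) ≤ ((k n + 1 : ℕ) : ℝ) := by exact_mod_cast hj
    have hj0 : (0 : ℝ) ≤ j := Nat.cast_nonneg j
    exact div_nonneg (by positivity) (mul_nonneg (by linarith) (by linarith))
  have hmain := card_mul_le_of_constantWeight S hS (k n) (by linarith) hkwN hkwN' c hc hck hcz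
    (n * M) (n * η) (by positivity) ?_ (fun x y hxy => by rw [← mul_add]; exact hd x y hxy)
  · have h2 : (n : ℝ) * (Fintype.card ι * η) ≤
        n * (Fintype.card {T : Finset (Fin n) // T.card ≤ k n} * (M + η)) := by
      linarith
    exact le_of_mul_le_mul_left h2 hnpos
  · intro j hj
    by_cases hjm : k n < j + m
    · obtain ⟨l, hl⟩ : ∃ l, k n = j + l := ⟨k n - j, by omega⟩
      have hlm : l < m := by omega
      have hj0 : j ≠ 0 := by omega
      have hn' := hn l (Finset.mem_range.2 hlm)
      have ej : k n - l = j := by omega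
      rw [ej] at hn'
      have c0 : c j = θ ^ l * p l := by
        simp only [c]
        rw [if_pos ⟨hj, hjm⟩, show k n - j = l by omega]
      have c1 : c (j - 1) = θ ^ l * (θ * p (l + 1)) := by
        simp only [c]
        rw [show k n - (j - 1) = l + 1 by omega]
        split_ifs with h
        · push_cast; ring
        · have : l + 1 = m := by omega
          have : (l : ℝ) + 1 = m := by exact_mod_cast this
          simp [p, this]
      have c2 : c (j + 1) = θ ^ l * (p (l - 1) / θ) := by
        rcases l with _ | l
        · rw [hcz (j + 1) (by omega)]
          simp [p]
        · simp only [c]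
          rw [if_pos ⟨by omega, by omega⟩, show k n - (j + 1) = l by omega]
          push_cast
          rw [add_sub_cancel_right, pow_succ]
          field_simp
      rw [if_neg hj0, c0, c1, c2]
      have h3 : hahnDiag n (w n) j * p l ≤ n * M * p l + hahnUp n (j - 1) * (θ * p (l + 1)) +
          hahnDown n (w n) (j + 1) * (p (l - 1) / θ) := by
        have := (mul_lt_mul_of_pos_left hn' hnpos).le
        refine (le_of_eq ?_).trans (this.trans (le_of_eq ?_))
        · field_simp
        · simp only [θ]
          field_simp
      have := mul_le_mul_of_nonneg_left h3 (pow_pos hθ l).le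
      linarith
    · have c0 : c j = 0 := by
        simp only [c]
        rw [if_neg (by omega)]
      rw [c0, mul_zero, mul_zero, zero_add]
      refine add_nonneg ?_ (mul_nonneg (hdownnn _ (by omega)) (hc _))
      split_ifs
      · exact le_rfl
      · exact mul_nonneg (hupnn _ (by omega)) (hc _)

end Asymptotics

section Entropy

open Filter Topology

lemma pow_mul_pow_eq_exp {n j : ℕ} {p : ℝ} (hp : 0 < p) (hp1 : p < 1) (hj : j ≤ n) :
    p ^ j * (1 - p) ^ (n - j) =
      Real.exp (-(n * Real.binEntropy p) + (j - n * p) * (Real.log p - Real.log (1 - p))) := by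
  have h1 : 0 < 1 - p := by linarith
  have e1 : p ^ j = Real.exp (j * Real.log p) := by
    rw [← Real.log_pow, Real.exp_log (pow_pos hp _)]
  have e2 : (1 - p) ^ (n - j) = Real.exp ((n - j : ℝ) * Real.log (1 - p)) := by
    rw [← Nat.cast_sub hj, ← Real.log_pow, Real.exp_log (pow_pos h1 _)]
  rw [e1, e2, ← Real.exp_add, Real.binEntropy_eq_negMulLog_add_negMulLog_one_sub]
  simp only [Real.negMulLog]
  congr 1
  ring

/-- The Hamming ball of radius `k ≤ n p`, `p ≤ 1/2`, has at most `exp (n H(p))` elements. -/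
lemma card_finset_card_le_le_exp {n k : ℕ} {p : ℝ} (hp : 0 < p) (hp1 : p ≤ 1 / 2)
    (hk : (k : ℝ) ≤ n * p) :
    (Fintype.card {T : Finset (Fin n) // T.card ≤ k} : ℝ) ≤ Real.exp (n * Real.binEntropy p) := by
  have h1 : ∀ T : {T : Finset (Fin n) // T.card ≤ k},
      Real.exp (-(n * Real.binEntropy p)) ≤ p ^ T.1.card * (1 - p) ^ (n - T.1.card) := by
    intro T
    have hT : T.1.card ≤ n := by simpa using Finset.card_le_univ T.1
    rw [pow_mul_pow_eq_exp hp (by linarith) hT]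
    apply Real.exp_le_exp.2
    have hl : Real.log p ≤ Real.log (1 - p) := Real.log_le_log hp (by linarith)
    have hc : (T.1.card : ℝ) ≤ k := by exact_mod_cast T.2
    nlinarith
  have h2 : ∑ T : {T : Finset (Fin n) // T.card ≤ k}, p ^ T.1.card * (1 - p) ^ (n - T.1.card)
      ≤ 1 := by
    have h3 := Fin.sum_pow_mul_eq_add_pow p (1 - p) (n := n)
    rw [add_sub_cancel, one_pow] at h3
    refine le_of_le_of_eq ?_ h3
    rw [← Finset.sum_subtype (p := fun T : Finset (Fin n) => T.card ≤ k)
      (Finset.univ.filter fun T : Finset (Fin n) => T.card ≤ k) (fun T => by simp)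
      (fun T : Finset (Fin n) => p ^ T.card * (1 - p) ^ (n - T.card))]
    apply Finset.sum_le_sum_of_subset_of_nonneg (Finset.filter_subset _ _)
    intro T _ _
    have : 0 < 1 - p := by linarith
    positivity
  have h4 := (Finset.sum_le_sum fun T (_ : T ∈ Finset.univ) => h1 T).trans h2
  rw [Finset.sum_const, Finset.card_univ, nsmul_eq_mul, Real.exp_neg,
    ← div_eq_mul_inv, div_le_one (Real.exp_pos _)] at h4
  exact h4

/-- The mode of the binomial distribution has probability at least `1 / (n + 1)`. -/
lemma one_le_succ_mul_binomial_mode {n w : ℕ} {p : ℝ} (hp : 0 < p) (hp1 : p < 1)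
    (hw : (w : ℝ) ≤ (n + 1) * p) (hw' : (n + 1) * p < w + 1) :
    1 ≤ (n + 1) * (n.choose w * (p ^ w * (1 - p) ^ (n - w))) := by
  have hq : 0 < 1 - p := by linarith
  have step : ∀ j : ℕ, j < n →
      (n.choose (j + 1) * (p ^ (j + 1) * (1 - p) ^ (n - (j + 1)))) * ((j + 1) * (1 - p)) =
      (n.choose j * (p ^ j * (1 - p) ^ (n - j))) * ((n - j) * p) := by
    intro j hj
    have e : ((n.choose (j + 1) : ℝ)) * (j + 1) = n.choose j * (n - j) := by
      have := Nat.choose_succ_right_eq n j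
      rw [← Nat.cast_sub hj.le]
      exact_mod_cast this
    have e2 : n - j = (n - (j + 1)) + 1 := by omega
    rw [e2]
    generalize n - (j + 1) = t
    linear_combination p ^ (j + 1) * (1 - p) ^ (t + 1) * e
  have hwn : w ≤ n := by
    have : (w : ℝ) < n + 1 := by nlinarith
    exact_mod_cast Nat.lt_succ_iff.1 (by exact_mod_cast this)
  set t : ℕ → ℝ := fun j => n.choose j * (p ^ j * (1 - p) ^ (n - j)) with ht
  have tpos : ∀ j, 0 ≤ t j := fun j => by positivity
  have up : ∀ j, w ≤ j → t j ≤ t w := by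
    intro j hj
    induction j, hj using Nat.le_induction with
    | base => exact le_rfl
    | succ j hj ih =>
      rcases lt_or_ge j n with h | h
      · refine le_trans ?_ ih
        have hs := step j h
        have hc : (w : ℝ) ≤ j := by exact_mod_cast hj
        have hle : (n - j : ℝ) * p ≤ (j + 1) * (1 - p) := by nlinarith
        have hpos : 0 < ((j : ℝ) + 1) * (1 - p) := by positivity
        have := mul_le_mul_of_nonneg_left hle (tpos j)
        exact le_of_mul_le_mul_right (hs.le.trans this) hpos
      · have : t (j + 1) = 0 := by
          simp [ht, Nat.choose_eq_zero_of_lt (Nat.lt_succ_of_le h)]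
        rw [this]; exact tpos w
  have down : ∀ i, i ≤ w → t (w - i) ≤ t w := by
    intro i
    induction i with
    | zero => intro _; exact le_rfl
    | succ i ih =>
      intro hi
      refine le_trans ?_ (ih (by omega))
      obtain ⟨j, hj⟩ : ∃ j, w - i = j + 1 := ⟨w - i - 1, by omega⟩
      have hj' : w - (i + 1) = j := by omega
      rw [hj', hj]
      have hjw : j + 1 ≤ w := by omega
      have hs := step j (by omega)
      have hc : (j : ℝ) + 1 ≤ w := by exact_mod_cast hjw
      have hle : (j + 1) * (1 - p) ≤ (n - j : ℝ) * p := by nlinarith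
      have hpos : 0 < ((j : ℝ) + 1) * (1 - p) := by positivity
      have := mul_le_mul_of_nonneg_left hle (tpos j)
      exact le_of_mul_le_mul_right (this.trans hs.ge) hpos
  have all : ∀ j, t j ≤ t w := by
    intro j
    rcases le_total w j with h | h
    · exact up j h
    · have := down (w - j) (by omega)
      rwa [Nat.sub_sub_self h] at this
  have hsum : ∑ j ∈ Finset.range (n + 1), t j = 1 := by
    have := add_pow p (1 - p) n
    rw [add_sub_cancel, one_pow] at this
    rw [this]
    exact Finset.sum_congr rfl fun j _ => by simp only [ht]; ring
  have h := Finset.sum_le_sum fun j (_ : j ∈ Finset.range (n + 1)) => all j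
  rw [hsum] at h
  simpa using h

lemma exp_mul_le_choose {n w : ℕ} {p : ℝ} (hp : 0 < p) (hp1 : p ≤ 1 / 2)
    (hw : (w : ℝ) ≤ (n + 1) * p) (hw' : (n + 1) * p < w + 1) :
    Real.exp (n * Real.binEntropy p) * p ≤ (n + 1) * n.choose w := by
  have h := one_le_succ_mul_binomial_mode hp (by linarith) hw hw'
  have hwn : w ≤ n := by
    have : (w : ℝ) < n + 1 := by nlinarith
    exact_mod_cast Nat.lt_succ_iff.1 (by exact_mod_cast this)
  rw [pow_mul_pow_eq_exp hp (by linarith) hwn, Real.exp_add, Real.exp_neg] at h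
  have hl : Real.log p ≤ Real.log (1 - p) := Real.log_le_log hp (by linarith)
  have hl1 : Real.log (1 - p) ≤ 0 := Real.log_nonpos (by linarith) (by linarith)
  have h2 : Real.exp ((w - n * p) * (Real.log p - Real.log (1 - p))) ≤ p⁻¹ := by
    rw [← Real.exp_log hp, ← Real.exp_neg, Real.exp_log hp]
    apply Real.exp_le_exp.2
    nlinarith
  have hE := Real.exp_pos (n * Real.binEntropy p)
  have h3 : 1 ≤ (n + 1) * (n.choose w * ((Real.exp (n * Real.binEntropy p))⁻¹ * p⁻¹)) := by
    refine h.trans ?_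
    gcongr
  have h4 := mul_le_mul_of_nonneg_left h3 (mul_pos hE hp).le
  rw [mul_one] at h4
  refine h4.trans (le_of_eq ?_)
  field_simp

/-- In every large dimension there is a weight `w` such that a `w`-uniform family containing a
fraction `exp (-n ρ) / 2` of all `w`-sets has two members whose difference is small. -/
theorem eventually_exists_close_pair {a b M ρ : ℝ} (hb : 0 < b) (hba : b < a) (ha : a ≤ 1 / 2)
    (hρ : ρ < Real.binEntropy a - Real.binEntropy b)
    (hM : (a * (1 - a) - b * (1 - b)) / (1 + 2 * √(b * (1 - b))) < M) :
    ∀ᶠ n : ℕ in atTop, ∃ w ≤ n, ∀ (ι : Type) [Fintype ι] (S : ι → Finset (Fin n)),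
      (∀ x, (S x).card = w) →
      Real.exp (-(n * ρ)) * n.choose w / 2 ≤ (Fintype.card ι : ℝ) →
      ∃ x y, x ≠ y ∧ ((S x \ S y).card : ℝ) < n * M := by
  set v := (a * (1 - a) - b * (1 - b)) / (1 + 2 * √(b * (1 - b))) with hv
  have hv0 : 0 ≤ v := by
    apply div_nonneg
    · nlinarith
    · positivity
  set η := (M - v) / 2 with hη
  have hη0 : 0 < η := by rw [hη]; linarith
  have hMη : v < M - η := by rw [hη]; linarith
  have ha0 : 0 < a := hb.trans hba
  have lim : ∀ (c x : ℝ), 0 < x → 0 ≤ c →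
      Tendsto (fun n : ℕ => ((⌊(n + c) * x⌋₊ : ℕ) : ℝ) / n) atTop (𝓝 x) := by
    intro c x hx hc
    have hinv := tendsto_const_div_atTop_nhds_zero_nat (c * x)
    have hinv1 := tendsto_const_div_atTop_nhds_zero_nat (1 : ℝ)
    have l1 : Tendsto (fun n : ℕ => x + c * x / n - 1 / n) atTop (𝓝 x) := by
      simpa using (tendsto_const_nhds (x := x)).add hinv |>.sub hinv1
    have l2 : Tendsto (fun n : ℕ => x + c * x / n) atTop (𝓝 x) := by
      simpa using (tendsto_const_nhds (x := x)).add hinv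
    refine tendsto_of_tendsto_of_tendsto_of_le_of_le' l1 l2 ?_ ?_
    · filter_upwards [eventually_gt_atTop 0] with n hn
      have hn' : (0 : ℝ) < n := by exact_mod_cast hn
      have := Nat.lt_floor_add_one ((n + c) * x)
      rw [le_div_iff₀ hn']
      have e : (x + c * x / n - 1 / n) * n = (n + c) * x - 1 := by field_simp
      linarith
    · filter_upwards [eventually_gt_atTop 0] with n hn
      have hn' : (0 : ℝ) < n := by exact_mod_cast hn
      have := Nat.floor_le (a := (n + c) * x) (by positivity)
      rw [div_le_iff₀ hn']
      have e : (x + c * x / n) * n = (n + c) * x := by field_simp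
      linarith
  have key := eventually_constantWeight_bound (w := fun n => ⌊((n : ℝ) + 1) * a⌋₊)
    (k := fun n => ⌊((n : ℝ) + 0) * b⌋₊) hb hba ha (lim 1 a ha0 zero_le_one) (lim 0 b hb le_rfl)
    hη0 hMη
  set c := Real.binEntropy a - Real.binEntropy b - ρ with hc
  have hc0 : 0 < c := by rw [hc]; linarith
  have growth : ∀ᶠ n : ℕ in atTop, 2 * M / (η * a) * (n + 1) < Real.exp (n * c) := by
    have h1 := tendsto_pow_const_mul_const_pow_of_abs_lt_one 1
      (r := Real.exp (-c)) (by rw [abs_of_pos (Real.exp_pos _)]; exact Real.exp_lt_one_iff.2 (by linarith))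
    have h0 := tendsto_pow_const_mul_const_pow_of_abs_lt_one 0
      (r := Real.exp (-c)) (by rw [abs_of_pos (Real.exp_pos _)]; exact Real.exp_lt_one_iff.2 (by linarith))
    have h2 := ((h1.add h0).const_mul (2 * M / (η * a)))
    rw [add_zero, mul_zero] at h2
    filter_upwards [h2.eventually (gt_mem_nhds one_pos)] with n hn
    rw [← Real.exp_nat_mul] at hn
    have e : Real.exp (n * c) * Real.exp (n * -c) = 1 := by rw [← Real.exp_add]; simp
    have := mul_lt_mul_of_pos_left hn (Real.exp_pos (n * c))
    rw [mul_one] at this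
    refine lt_of_eq_of_lt ?_ this
    linear_combination (-(2 * M / (η * a)) * (n + 1)) * e
  filter_upwards [key, growth] with n hn hg
  have hw1 := Nat.floor_le (a := ((n : ℝ) + 1) * a) (by positivity)
  have hw2 := Nat.lt_floor_add_one (((n : ℝ) + 1) * a)
  have hk1 := Nat.floor_le (a := ((n : ℝ) + 0) * b) (by positivity)
  rw [add_zero] at hk1
  refine ⟨⌊((n : ℝ) + 1) * a⌋₊, ?_, ?_⟩
  · have : ((⌊((n : ℝ) + 1) * a⌋₊ : ℕ) : ℝ) < n + 1 := by nlinarith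
    exact_mod_cast Nat.lt_succ_iff.1 (by exact_mod_cast this)
  intro ι _ S hS hcard
  have hch := exp_mul_le_choose ha0 ha hw1 hw2
  have hD := card_finset_card_le_le_exp (n := n) hb (by linarith) hk1
  rw [add_zero] at hn
  generalize ⌊((n : ℝ) + 1) * a⌋₊ = w at *
  have hchpos : (0 : ℝ) < n.choose w := by
    have : 0 < Real.exp (n * Real.binEntropy a) * a := by positivity
    by_contra hcon
    nlinarith
  have hpos : (0 : ℝ) < Fintype.card ι := lt_of_lt_of_le (by positivity) hcard
  have : Nonempty ι := Fintype.card_pos_iff.1 (by exact_mod_cast hpos)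
  by_contra! hcon
  have hb4 := hn ι S hS (fun x y hxy => by rw [sub_add_cancel]; exact hcon x y hxy)
  rw [sub_add_cancel] at hb4
  have hMpos : 0 < M := by linarith
  have e1 : Real.exp (n * Real.binEntropy a) =
      Real.exp (n * Real.binEntropy b) * Real.exp (n * ρ) * Real.exp (n * c) := by
    rw [← Real.exp_add, ← Real.exp_add]; congr 1; rw [hc]; ring
  have i1 : Real.exp (-(n * ρ)) * n.choose w / 2 * η ≤ Real.exp (n * Real.binEntropy b) * M :=
    (mul_le_mul_of_nonneg_right hcard hη0.le).trans
      (hb4.trans (mul_le_mul_of_nonneg_right hD hMpos.le))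
  rw [Real.exp_neg] at i1
  have hEρ := Real.exp_pos (n * ρ)
  have hEb := Real.exp_pos (n * Real.binEntropy b)
  have i2 : n.choose w * η ≤
      Real.exp (n * Real.binEntropy b) * M * 2 * Real.exp (n * ρ) := by
    have := mul_le_mul_of_nonneg_left i1 (mul_pos two_pos hEρ).le
    refine le_trans (le_of_eq ?_) (this.trans (le_of_eq ?_))
    · field_simp
    · ring
  have i3 : Real.exp (n * Real.binEntropy b) * Real.exp (n * ρ) * (Real.exp (n * c) * (η * a)) ≤
      Real.exp (n * Real.binEntropy b) * Real.exp (n * ρ) * (2 * M * (n + 1)) := by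
    rw [e1] at hch
    have hn1 : (0 : ℝ) ≤ n + 1 := by positivity
    have j1 := mul_le_mul_of_nonneg_right hch hη0.le
    have j2 := mul_le_mul_of_nonneg_left i2 hn1
    nlinarith
  have i4 := le_of_mul_le_mul_left i3 (mul_pos hEb hEρ)
  have i5 : 2 * M * (n + 1) < Real.exp (n * c) * (η * a) := by
    have := mul_lt_mul_of_pos_right hg (mul_pos hη0 ha0)
    refine lt_of_eq_of_lt ?_ this
    field_simp
  linarith

end Entropy

section Channel

lemma ZMod.one_ne_zero_of_two_le {q : ℕ} (hq : 2 ≤ q) : (1 : ZMod q) ≠ 0 := by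
  have : Fact (1 < q) := ⟨hq⟩
  exact one_ne_zero

lemma W_nonneg {q : ℕ} {ε : ℝ} (h0 : 0 ≤ ε) (h1 : ε ≤ 1) (y x : ZMod q) : 0 ≤ W q ε y x := by
  unfold W
  split_ifs <;> linarith

lemma Wn_nonneg {q : ℕ} [NeZero q] {ε : ℝ} (h0 : 0 ≤ ε) (h1 : ε ≤ 1) {n : ℕ}
    (y x : Fin n → ZMod q) : 0 ≤ Wn q n ε y x :=
  Finset.prod_nonneg fun _ _ => W_nonneg h0 h1 _ _

lemma sum_W {q : ℕ} [NeZero q] (hq : 2 ≤ q) (ε : ℝ) (x : ZMod q) : ∑ y, W q ε y x = 1 := by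
  have h1 := ZMod.one_ne_zero_of_two_le hq
  have e : ∀ y, W q ε y x = (if y = x then 1 - ε else 0) + (if y = x + 1 then ε else 0) := by
    intro y
    unfold W
    by_cases h : y = x
    · subst h; simp [h1]
    · simp [h]
  simp [e, Finset.sum_add_distrib]

/-- The word obtained from `u` by adding one on the positions in `S`. -/
def shiftWord {q n : ℕ} (u : Fin n → ZMod q) (S : Finset (Fin n)) (k : Fin n) : ZMod q :=
  u k + if k ∈ S then 1 else 0

lemma shiftWord_injective {q n : ℕ} (hq : 2 ≤ q) (u : Fin n → ZMod q) :
    Function.Injective (shiftWord u) := by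
  intro S T h
  have h1 := ZMod.one_ne_zero_of_two_le hq
  ext k
  have := congrFun h k
  by_cases hS : k ∈ S <;> by_cases hT : k ∈ T <;> simp_all [shiftWord]

/-- Common part of the output laws of two shifted words at one position. -/
noncomputable def commonLaw {q n : ℕ} (ε : ℝ) (u : Fin n → ZMod q) (S T : Finset (Fin n))
    (k : Fin n) (y : ZMod q) : ℝ :=
  if k ∈ S ↔ k ∈ T then W q ε y (shiftWord u S k) else if y = u k + 1 then 1 else 0

lemma commonLaw_comm {q n : ℕ} (ε : ℝ) (u : Fin n → ZMod q) (S T : Finset (Fin n)) :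
    commonLaw ε u S T = commonLaw ε u T S := by
  ext k y
  by_cases hS : k ∈ S <;> by_cases hT : k ∈ T <;> simp [commonLaw, shiftWord, hS, hT]

lemma sum_prod_commonLaw {q n : ℕ} [NeZero q] (hq : 2 ≤ q) (ε : ℝ) (u : Fin n → ZMod q)
    (S T : Finset (Fin n)) :
    ∑ y : Fin n → ZMod q, ∏ k, commonLaw ε u S T k (y k) = 1 := by
  rw [← Fintype.piFinset_univ, ← Finset.prod_univ_sum]
  apply Finset.prod_eq_one
  intro k _
  by_cases h : k ∈ S ↔ k ∈ T
  · simp only [commonLaw, h, if_true]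
    exact sum_W hq ε _
  · simp [commonLaw, h]

lemma commonLaw_le_W {q n : ℕ} (hq : 2 ≤ q) {ε : ℝ} (h0 : 0 ≤ ε) (h1 : ε ≤ 1)
    (u : Fin n → ZMod q) (S T : Finset (Fin n)) (k : Fin n) (y : ZMod q) :
    ((if k ∈ S \ T then 1 - ε else 1) * (if k ∈ T \ S then ε else 1)) * commonLaw ε u S T k y ≤
      W q ε y (shiftWord u S k) := by
  have hone := ZMod.one_ne_zero_of_two_le hq
  have hW := fun x => W_nonneg h0 h1 y x
  by_cases hS : k ∈ S <;> by_cases hT : k ∈ T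
  · simp [commonLaw, hS, hT]
  · by_cases hy : y = u k + 1
    · simp [commonLaw, shiftWord, hS, hT, hy, W]
    · simpa [commonLaw, shiftWord, hS, hT, hy] using hW _
  · by_cases hy : y = u k + 1
    · simp [commonLaw, shiftWord, hS, hT, hy, W, hone]
    · simpa [commonLaw, shiftWord, hS, hT, hy] using hW _
  · simp [commonLaw, hS, hT]

lemma prod_commonLaw_le_Wn {q n : ℕ} [NeZero q] (hq : 2 ≤ q) {ε : ℝ} (h0 : 0 ≤ ε) (h1 : ε ≤ 1)
    (u : Fin n → ZMod q) (S T : Finset (Fin n)) (y : Fin n → ZMod q) :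
    (1 - ε) ^ (S \ T).card * ε ^ (T \ S).card * ∏ k, commonLaw ε u S T k (y k) ≤
      Wn q n ε y (shiftWord u S) := by
  have e : (1 - ε) ^ (S \ T).card * ε ^ (T \ S).card =
      ∏ k, ((if k ∈ S \ T then 1 - ε else 1) * (if k ∈ T \ S then ε else 1)) := by
    rw [Finset.prod_mul_distrib, Finset.prod_ite_mem, Finset.prod_ite_mem]
    simp
  rw [e, ← Finset.prod_mul_distrib]
  apply Finset.prod_le_prod
  · intro k _
    have hε : 0 ≤ 1 - ε := by linarith
    have := fun x => W_nonneg h0 h1 (y k) x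
    apply mul_nonneg
    · positivity
    · unfold commonLaw
      split_ifs <;> first | exact this _ | norm_num
  · intro k _
    exact commonLaw_le_W hq h0 h1 u S T k (y k)

/-- Two messages whose codewords are shifts of the same word cannot both be decoded reliably. -/
lemma pow_le_error_add_error {q n M : ℕ} [NeZero q] (hq : 2 ≤ q) {ε : ℝ} (h0 : 0 ≤ ε) (h1 : ε ≤ 1)
    (φ : (Fin n → ZMod q) → Fin M) (u : Fin n → ZMod q) {S T : Finset (Fin n)}
    (hST : S.card = T.card) {m m' : Fin M} (hm : m ≠ m') :
    (ε * (1 - ε)) ^ (S \ T).card ≤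
      (∑ y, if φ y = m then 0 else Wn q n ε y (shiftWord u S)) +
        ∑ y, if φ y = m' then 0 else Wn q n ε y (shiftWord u T) := by
  have hc : (T \ S).card = (S \ T).card := by
    have := Finset.card_sdiff_add_card S T
    have := Finset.card_sdiff_add_card T S
    rw [Finset.union_comm] at this
    omega
  have e : (ε * (1 - ε)) ^ (S \ T).card = ∑ y : Fin n → ZMod q,
      (1 - ε) ^ (S \ T).card * ε ^ (T \ S).card * ∏ k, commonLaw ε u S T k (y k) := by
    rw [← Finset.mul_sum, sum_prod_commonLaw hq, hc, mul_pow]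
    ring
  rw [e, ← Finset.sum_add_distrib]
  apply Finset.sum_le_sum
  intro y _
  have a1 := prod_commonLaw_le_Wn hq h0 h1 u S T y
  have a2 := prod_commonLaw_le_Wn hq h0 h1 u T S y
  rw [commonLaw_comm, hc, ← hc] at a2
  have n1 := Wn_nonneg h0 h1 y (shiftWord u S)
  have n2 := Wn_nonneg h0 h1 y (shiftWord u T)
  by_cases h : φ y = m
  · have h' : φ y ≠ m' := fun h'' => hm (h.symm.trans h'')
    rw [if_pos h, if_neg h', zero_add]
    rw [hc] at a2 ⊢
    exact a2
  · rw [if_neg h]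
    split_ifs <;> linarith

/-- At least half of the terms of a nonnegative family are at most twice its average. -/
lemma card_le_two_mul_card_filter_le {M : ℕ} (e : Fin M → ℝ) (he : ∀ m, 0 ≤ e m) {P : ℝ}
    (hP : ∑ m, e m = M * P) : (M : ℝ) / 2 ≤ (Finset.univ.filter fun m => e m ≤ 2 * P).card := by
  classical
  have hsplit : (Finset.univ.filter fun m => e m ≤ 2 * P).card +
      (Finset.univ.filter fun m => ¬ e m ≤ 2 * P).card = M := by
    rw [Finset.card_filter_add_card_filter_not]; simp
  have hsplit' : ((Finset.univ.filter fun m => e m ≤ 2 * P).card : ℝ) +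
      (Finset.univ.filter fun m => ¬ e m ≤ 2 * P).card = M := by exact_mod_cast hsplit
  by_contra! hcon
  set B := Finset.univ.filter fun m => ¬ e m ≤ 2 * P with hB
  have hb : (M : ℝ) / 2 < B.card := by linarith
  have hBne : B.Nonempty := by
    rw [← Finset.card_pos]
    have : (0 : ℝ) < B.card := lt_of_le_of_lt (by positivity) hb
    exact_mod_cast this
  have h1 : (B.card : ℝ) * (2 * P) < ∑ m ∈ B, e m := by
    rw [← nsmul_eq_mul, ← Finset.sum_const]
    apply Finset.sum_lt_sum_of_nonempty hBne
    intro m hm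
    simpa [hB] using hm
  have h2 : ∑ m ∈ B, e m ≤ ∑ m, e m :=
    Finset.sum_le_sum_of_subset_of_nonneg (Finset.subset_univ _) fun m _ _ => he m
  have hMP : 0 ≤ M * P := hP ▸ Finset.sum_nonneg fun m _ => he m
  have hM0 : (0 : ℝ) < M := by
    obtain ⟨m, _⟩ := hBne
    exact_mod_cast m.pos
  have hP0 : 0 ≤ P := nonneg_of_mul_nonneg_right hMP hM0
  nlinarith

/-- Pigeonhole: many codewords from any large set are `w`-shifts of a common word. -/
lemma exists_shiftWord_fiber {q n M : ℕ} [NeZero q] (f : Fin M → Fin n → ZMod q)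
    (G : Finset (Fin M)) (w : ℕ) :
    ∃ u : Fin n → ZMod q, (G.card : ℝ) * n.choose w / (q : ℝ) ^ n ≤
      Fintype.card {p : Fin M × Finset (Fin n) //
        p.1 ∈ G ∧ p.2.card = w ∧ f p.1 = shiftWord u p.2} := by
  classical
  set A := G ×ˢ Finset.powersetCard w (Finset.univ : Finset (Fin n)) with hA
  let g : Fin M × Finset (Fin n) → Fin n → ZMod q :=
    fun p k => f p.1 k - if k ∈ p.2 then 1 else 0
  have hqn : (0 : ℝ) < (q : ℝ) ^ n := by
    have : (0 : ℝ) < q := by exact_mod_cast Nat.pos_of_ne_zero (NeZero.ne q)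
    positivity
  obtain ⟨u, -, hu⟩ := Finset.exists_le_of_sum_le (s := (Finset.univ : Finset (Fin n → ZMod q)))
    Finset.univ_nonempty
    (f := fun _ => (G.card : ℝ) * n.choose w / (q : ℝ) ^ n)
    (g := fun u => ((A.filter fun p => g p = u).card : ℝ)) (by
      rw [← Nat.cast_sum, ← Finset.card_eq_sum_card_fiberwise (fun _ _ => Finset.mem_univ _)]
      rw [Finset.sum_const, Finset.card_univ, Fintype.card_fun, ZMod.card, Fintype.card_fin, hA,
        Finset.card_product, Finset.card_powersetCard, Finset.card_univ, Fintype.card_fin,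
        nsmul_eq_mul]
      push_cast
      rw [mul_div_cancel₀ _ hqn.ne'])
  refine ⟨u, hu.trans (le_of_eq ?_)⟩
  rw [Fintype.card_subtype]
  congr 2
  ext p
  have : g p = u ↔ f p.1 = shiftWord u p.2 := by
    constructor
    · rintro rfl; ext k; simp [g, shiftWord]
    · intro h; ext k; simp [g, h, shiftWord]
  simp [hA, this, Finset.mem_powersetCard, and_assoc]

end Channel

section ErrorProbability

open Filter Topology

lemma Pe_le_one {q : ℕ} [NeZero q] (hq : 2 ≤ q) {ε : ℝ} (h0 : 0 ≤ ε) (h1 : ε ≤ 1) (n : ℕ) {M : ℕ}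
    (hM : 0 < M) : Pe q ε M n ≤ 1 := by
  have hM' : (0 : ℝ) < M := by exact_mod_cast hM
  refine csInf_le_of_le (b := (1 / M) * ∑ m : Fin M, ∑ y : Fin n → ZMod q,
      if (⟨0, hM⟩ : Fin M) = m then 0 else Wn q n ε y (fun _ => 0)) ⟨0, ?_⟩
    ⟨fun _ _ => 0, fun _ => ⟨0, hM⟩, rfl⟩ ?_
  · rintro _ ⟨f, φ, rfl⟩
    refine mul_nonneg (by positivity) (Finset.sum_nonneg fun m _ => Finset.sum_nonneg fun y _ => ?_)
    split_ifs
    · exact le_rfl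
    · exact Wn_nonneg h0 h1 _ _
  · have hs : ∑ y : Fin n → ZMod q, Wn q n ε y (fun _ => 0) = 1 := by
      unfold Wn
      rw [← Fintype.piFinset_univ,
        ← Finset.prod_univ_sum (fun _ : Fin n => Finset.univ) (fun _ y => W q ε y 0)]
      exact Finset.prod_eq_one fun _ _ => sum_W hq ε 0
    have hle : ∑ m : Fin M, ∑ y : Fin n → ZMod q,
        (if (⟨0, hM⟩ : Fin M) = m then 0 else Wn q n ε y (fun _ => 0)) ≤ ∑ m : Fin M, (1 : ℝ) := by
      apply Finset.sum_le_sum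
      intro m _
      rw [← hs]
      apply Finset.sum_le_sum
      intro y _
      split_ifs
      · exact Wn_nonneg h0 h1 _ _
      · exact le_rfl
    rw [Finset.sum_const, Finset.card_univ, Fintype.card_fin, nsmul_eq_mul, mul_one] at hle
    rw [one_div, inv_mul_le_iff₀ hM', mul_one]
    exact hle

/-- A code that contains two close words in every dense shift class has a large error. -/
lemma le_Pe_of_close_pair {q : ℕ} [NeZero q] (hq : 2 ≤ q) {ε : ℝ} (h0 : 0 < ε) (h1 : ε < 1)
    {n M w : ℕ} (hM : 0 < M) {D N : ℝ} (hN : N ≤ M * n.choose w / (q : ℝ) ^ n / 2)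
    (hS : ∀ (ι : Type) [Fintype ι] (S : ι → Finset (Fin n)), (∀ x, (S x).card = w) →
      N ≤ (Fintype.card ι : ℝ) → ∃ x y, x ≠ y ∧ ((S x \ S y).card : ℝ) < D) :
    (1 / 4) * (ε * (1 - ε)) ^ D ≤ Pe q ε M n := by
  have hM' : (0 : ℝ) < M := by exact_mod_cast hM
  refine le_csInf ⟨_, fun _ _ => 0, fun _ => ⟨0, hM⟩, rfl⟩ ?_
  rintro P ⟨f, φ, hP⟩
  set e : Fin M → ℝ := fun m => ∑ y : Fin n → ZMod q, if φ y = m then 0 else Wn q n ε y (f m)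
    with he
  have he0 : ∀ m, 0 ≤ e m := fun m => Finset.sum_nonneg fun y _ => by
    split_ifs
    · exact le_rfl
    · exact Wn_nonneg h0.le h1.le _ _
  have hsum : ∑ m, e m = M * P := by rw [hP, ← mul_assoc, mul_one_div_cancel hM'.ne', one_mul]
  have hG := card_le_two_mul_card_filter_le e he0 hsum
  set G := Finset.univ.filter fun m => e m ≤ 2 * P
  obtain ⟨u, hu⟩ := exists_shiftWord_fiber f G w
  have hcard : N ≤ Fintype.card {p : Fin M × Finset (Fin n) //
      p.1 ∈ G ∧ p.2.card = w ∧ f p.1 = shiftWord u p.2} := by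
    refine hN.trans (le_trans ?_ hu)
    have : (M : ℝ) * n.choose w / (q : ℝ) ^ n / 2 = (M / 2) * n.choose w / (q : ℝ) ^ n := by ring
    rw [this]
    gcongr
  obtain ⟨⟨⟨m, S⟩, hmG, hSw, hfm⟩, ⟨⟨m', T⟩, hmG', hTw, hfm'⟩, hne, hlt⟩ :=
    hS _ (fun p => p.1.2) (fun p => p.2.2.1) hcard
  simp only at hmG hSw hfm hmG' hTw hfm' hlt
  have hmm : m ≠ m' := by
    rintro rfl
    have := shiftWord_injective hq u (hfm.symm.trans hfm')
    subst this
    exact hne rfl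
  have hpair := pow_le_error_add_error hq h0.le h1.le φ u (hSw.trans hTw.symm) hmm
  rw [← hfm, ← hfm'] at hpair
  have g1 : e m ≤ 2 * P := (Finset.mem_filter.1 hmG).2
  have g2 : e m' ≤ 2 * P := (Finset.mem_filter.1 hmG').2
  have hpos : 0 < ε * (1 - ε) := mul_pos h0 (by linarith)
  have hle1 : ε * (1 - ε) ≤ 1 := by nlinarith
  have hr := Real.rpow_le_rpow_of_exponent_ge hpos hle1 hlt.le
  rw [Real.rpow_natCast] at hr
  have : (ε * (1 - ε)) ^ (S \ T).card ≤ e m + e m' := hpair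
  linarith

theorem eventually_le_Pe {q : ℕ} [NeZero q] (hq : 2 ≤ q) {ε R a b M : ℝ} (h0 : 0 < ε) (h1 : ε < 1)
    (hb : 0 < b) (hba : b < a) (ha : a ≤ 1 / 2)
    (hρ : Real.log q - R * Real.log 2 < Real.binEntropy a - Real.binEntropy b)
    (hM : (a * (1 - a) - b * (1 - b)) / (1 + 2 * √(b * (1 - b))) < M) :
    ∀ᶠ n : ℕ in atTop, (1 / 4) * (ε * (1 - ε)) ^ ((n : ℝ) * M) ≤
      Pe q ε ⌈(2 : ℝ) ^ ((n : ℝ) * R)⌉₊ n := by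
  have hq0 : (0 : ℝ) < q := by exact_mod_cast Nat.pos_of_ne_zero (NeZero.ne q)
  filter_upwards [eventually_exists_close_pair hb hba ha hρ hM] with n hn
  obtain ⟨w, -, hS⟩ := hn
  refine le_Pe_of_close_pair hq h0 h1 (Nat.ceil_pos.2 (by positivity)) ?_ hS
  have hc := Nat.le_ceil ((2 : ℝ) ^ ((n : ℝ) * R))
  have e : Real.exp (-(n * (Real.log q - R * Real.log 2))) =
      (2 : ℝ) ^ ((n : ℝ) * R) / (q : ℝ) ^ n := by
    rw [Real.rpow_def_of_pos two_pos, ← Real.rpow_natCast, Real.rpow_def_of_pos hq0,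
      ← Real.exp_sub]
    congr 1
    ring
  rw [e, div_mul_eq_mul_div]
  gcongr

end ErrorProbability

section Reliability

open Filter Topology

lemma h2_eq_binEntropy_div (x : ℝ) : h2 x = Real.binEntropy x / Real.log 2 := by
  rw [Real.binEntropy_eq_negMulLog_add_negMulLog_one_sub]
  simp only [h2, Real.logb, Real.negMulLog]
  ring

lemma continuous_h2 : Continuous h2 := by
  have : h2 = fun x => Real.binEntropy x / Real.log 2 := funext h2_eq_binEntropy_div
  rw [this]
  fun_prop

lemma strictMonoOn_h2 : StrictMonoOn h2 (Set.Icc 0 2⁻¹) := by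
  intro x hx y hy hxy
  rw [h2_eq_binEntropy_div, h2_eq_binEntropy_div]
  exact div_lt_div_of_pos_right (Real.binEntropy_strictMonoOn hx hy hxy) (Real.log_pos one_lt_two)

lemma h2_zero : h2 0 = 0 := by simp [h2]

lemma h2_half : h2 (1 / 2) = 1 := by
  rw [h2_eq_binEntropy_div, one_div, Real.binEntropy_two_inv]
  exact div_self (ne_of_gt (Real.log_pos one_lt_two))

/-- The objective function in the definition of `deltaLP2`. -/
noncomputable def lpValue (a b : ℝ) : ℝ :=
  2 * (a * (1 - a) - b * (1 - b)) / (1 + 2 * √(b * (1 - b)))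

lemma continuous_lpValue : Continuous fun p : ℝ × ℝ => lpValue p.1 p.2 := by
  unfold lpValue
  refine Continuous.div (by fun_prop) (by fun_prop) fun p => ?_
  positivity

/-- Feasible points can be approximated by interior ones with strict entropy gap. -/
lemma exists_interior_feasible {a b s c : ℝ} (hb : 0 ≤ b) (hba : b ≤ a) (ha : a ≤ 1 / 2)
    (hs : 0 < s) (hs1 : s < 1) (h : s ≤ h2 a - h2 b) (hc : lpValue a b < c) :
    ∃ a' b', 0 < b' ∧ b' < a' ∧ a' ≤ 1 / 2 ∧ s < h2 a' - h2 b' ∧ lpValue a' b' < c := by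
  have hba' : b < a := lt_of_le_of_ne hba (by rintro rfl; simp at h; linarith)
  rcases hb.eq_or_lt with rfl | hb
  · obtain ⟨a', ha0', ha', hs', hc'⟩ :
        ∃ a', 0 < a' ∧ a' ≤ 1 / 2 ∧ s < h2 a' - h2 0 ∧ lpValue a' 0 < c := by
      rcases ha.eq_or_lt with rfl | ha
      · exact ⟨1 / 2, by norm_num, le_rfl, by rw [h2_half, h2_zero]; linarith, hc⟩
      · have hcont : Continuous fun x => lpValue x 0 :=
          continuous_lpValue.comp (Continuous.prodMk continuous_id continuous_const)
        have e1 : ∀ᶠ x in 𝓝[>] a, lpValue x 0 < c :=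
          (hcont.continuousAt.eventually_lt continuousAt_const hc).filter_mono nhdsWithin_le_nhds
        have e2 : ∀ᶠ x in 𝓝[>] a, x < 1 / 2 :=
          (eventually_lt_nhds ha).filter_mono nhdsWithin_le_nhds
        obtain ⟨x, h1, h2', h3⟩ := (e1.and (e2.and self_mem_nhdsWithin)).exists
        have h3 : a < x := h3
        have := strictMonoOn_h2 (a := a) (b := x) ⟨hba, by linarith⟩ ⟨by linarith, by linarith⟩ h3
        exact ⟨x, by linarith, h2'.le, by linarith, h1⟩
    have hcont : Continuous fun x => lpValue a' x :=
      continuous_lpValue.comp (Continuous.prodMk continuous_const continuous_id)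
    have hcont2 : Continuous fun x => h2 a' - h2 x := continuous_const.sub continuous_h2
    have e1 : ∀ᶠ x in 𝓝[>] (0 : ℝ), lpValue a' x < c :=
      (hcont.continuousAt.eventually_lt continuousAt_const hc').filter_mono nhdsWithin_le_nhds
    have e2 : ∀ᶠ x in 𝓝[>] (0 : ℝ), x < a' :=
      (eventually_lt_nhds ha0').filter_mono nhdsWithin_le_nhds
    have e3 : ∀ᶠ x in 𝓝[>] (0 : ℝ), s < h2 a' - h2 x :=
      (continuousAt_const.eventually_lt hcont2.continuousAt hs').filter_mono nhdsWithin_le_nhds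
    obtain ⟨x, h1, h2', h3, h4⟩ := (e1.and (e2.and (e3.and self_mem_nhdsWithin))).exists
    exact ⟨a', x, h4, h2', ha', h3, h1⟩
  · have hcont : Continuous fun x => lpValue a x :=
      continuous_lpValue.comp (Continuous.prodMk continuous_const continuous_id)
    have e1 : ∀ᶠ x in 𝓝[<] b, lpValue a x < c :=
      (hcont.continuousAt.eventually_lt continuousAt_const hc).filter_mono nhdsWithin_le_nhds
    have e2 : ∀ᶠ x in 𝓝[<] b, 0 < x :=
      (eventually_gt_nhds hb).filter_mono nhdsWithin_le_nhds
    obtain ⟨x, h1, h2', h3⟩ := (e1.and (e2.and self_mem_nhdsWithin)).exists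
    have h3 : x < b := h3
    have := strictMonoOn_h2 (a := x) (b := b) ⟨h2'.le, by linarith⟩ ⟨by linarith, by linarith⟩ h3
    exact ⟨a, x, h2', by linarith, ha, by linarith, h1⟩

lemma logb_inv_alphaE {ε : ℝ} (h0 : 0 < ε) (h1 : ε < 1) :
    Real.logb 2 (1 / alphaE ε) = -(Real.log (ε * (1 - ε)) / (2 * Real.log 2)) := by
  have : 0 < ε * (1 - ε) := mul_pos h0 (by linarith)
  rw [alphaE, one_div, Real.logb_inv, Real.logb, Real.log_sqrt this.le]
  ring

lemma logb_inv_alphaE_pos {ε : ℝ} (h0 : 0 < ε) (h1 : ε < 1) :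
    0 < Real.logb 2 (1 / alphaE ε) := by
  rw [logb_inv_alphaE h0 h1, neg_pos]
  apply div_neg_of_neg_of_pos
  · exact Real.log_neg (mul_pos h0 (by linarith)) (by nlinarith)
  · have := Real.log_pos one_lt_two
    positivity

lemma EReliability_le_of_feasible {q : ℕ} [NeZero q] (hq : 2 ≤ q) {ε R a b c : ℝ} (h0 : 0 < ε)
    (h1 : ε < 1) (hb : 0 < b) (hba : b < a) (ha : a ≤ 1 / 2)
    (hgap : Real.logb 2 q - R < h2 a - h2 b) (hc : lpValue a b < c) :
    EReliability q ε R ≤ c * Real.logb 2 (1 / alphaE ε) := by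
  have hlog2 := Real.log_pos one_lt_two
  set c' := (lpValue a b + c) / 2 with hc'
  have hρ : Real.log q - R * Real.log 2 < Real.binEntropy a - Real.binEntropy b := by
    rw [h2_eq_binEntropy_div, h2_eq_binEntropy_div, Real.logb, ← sub_div] at hgap
    have := mul_lt_mul_of_pos_right hgap hlog2
    rwa [sub_mul, div_mul_cancel₀ _ hlog2.ne', div_mul_cancel₀ _ hlog2.ne'] at this
  have hM : (a * (1 - a) - b * (1 - b)) / (1 + 2 * √(b * (1 - b))) < c' / 2 := by
    have : lpValue a b = 2 * ((a * (1 - a) - b * (1 - b)) / (1 + 2 * √(b * (1 - b)))) := by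
      rw [lpValue, mul_div_assoc]
    linarith
  have hA := logb_inv_alphaE_pos h0 h1
  have hε : 0 < ε * (1 - ε) := mul_pos h0 (by linarith)
  have hlim : Tendsto (fun n : ℕ => (2 : ℝ) / n) atTop (𝓝 0) :=
    tendsto_const_div_atTop_nhds_zero_nat 2
  have hsmall : ∀ᶠ n : ℕ in atTop, (2 : ℝ) / n < (c - c') * Real.logb 2 (1 / alphaE ε) :=
    hlim.eventually (gt_mem_nhds (mul_pos (by linarith) hA))
  have hev := eventually_le_Pe hq h0 h1 hb hba ha hρ hM
  have hpos : ∀ᶠ n : ℕ in atTop, 0 < Pe q ε ⌈(2 : ℝ) ^ ((n : ℝ) * R)⌉₊ n := by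
    filter_upwards [hev] with n hn
    exact lt_of_lt_of_le (by positivity) hn
  refine Filter.limsup_le_of_le ?_ ?_
  · apply IsBoundedUnder.isCoboundedUnder_le
    refine ⟨0, ?_⟩
    rw [eventually_map]
    filter_upwards [hpos] with n hn
    refine mul_nonneg (by positivity) (Real.logb_nonneg one_lt_two ?_)
    rw [le_div_iff₀ hn, one_mul]
    exact Pe_le_one hq h0.le h1.le n (Nat.ceil_pos.2 (by positivity))
  · filter_upwards [hev, hsmall, hpos, eventually_gt_atTop 0] with n hn hs hp hn0
    have hn0' : (0 : ℝ) < n := by exact_mod_cast hn0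
    have e1 : Real.logb 2 (1 / Pe q ε ⌈(2 : ℝ) ^ ((n : ℝ) * R)⌉₊ n) ≤
        2 + n * (c' * Real.logb 2 (1 / alphaE ε)) := by
      rw [one_div, Real.logb_inv, Real.logb, logb_inv_alphaE h0 h1]
      have h4 := Real.log_le_log (by positivity) hn
      have hl4 : Real.log (1 / 4) = -(2 * Real.log 2) := by
        rw [one_div, Real.log_inv, show (4 : ℝ) = 2 ^ 2 by norm_num, Real.log_pow]
        norm_num
      rw [Real.log_mul (by norm_num) (by positivity), Real.log_rpow hε, hl4] at h4
      have h5 := div_le_div_of_nonneg_right h4 hlog2.le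
      have h6 : (-(2 * Real.log 2) + n * (c' / 2) * Real.log (ε * (1 - ε))) / Real.log 2 =
          -(2 + n * (c' * -(Real.log (ε * (1 - ε)) / (2 * Real.log 2)))) := by
        field_simp
        ring
      rw [h6] at h5
      linarith
    have e2 : (1 / (n : ℝ)) * (2 + n * (c' * Real.logb 2 (1 / alphaE ε))) =
        2 / n + c' * Real.logb 2 (1 / alphaE ε) := by
      field_simp
    have e3 := mul_le_mul_of_nonneg_left e1 (by positivity : 0 ≤ 1 / (n : ℝ))
    rw [e2] at e3
    linarith

end Reliability

theorem stmt6 (q : ℕ) [NeZero q] (hq : 4 ≤ q)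
    (ε : ℝ) (hε : 0 < ε) (hε' : ε ≤ 1 / 2)
    (R : ℝ) (hR1 : Real.logb 2 ((q : ℝ) / 2) < R) (hR2 : R < Real.logb 2 (q : ℝ)) :
    EReliability q ε R ≤
      deltaLP2 (R - Real.logb 2 ((q : ℝ) / 2)) * Real.logb 2 (1 / alphaE ε) := by
  have hq0 : (q : ℝ) ≠ 0 := by exact_mod_cast NeZero.ne q
  have hε1 : ε < 1 := by linarith
  have hlog : Real.logb 2 ((q : ℝ) / 2) = Real.logb 2 q - 1 := by
    rw [Real.logb_div hq0 two_ne_zero, Real.logb_self_eq_one one_lt_two]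
  rw [hlog] at hR1 ⊢
  have hA := logb_inv_alphaE_pos hε hε1
  rw [← div_le_iff₀ hA]
  refine le_csInf ⟨_, 1 / 2, 0, le_rfl, by norm_num, le_rfl, ?_, rfl⟩ ?_
  · rw [h2_half, h2_zero]
    linarith
  rintro d ⟨a, b, hb, hba, ha, hgap, hd⟩
  change d = lpValue a b at hd
  rw [hd]
  refine le_of_forall_gt fun c hc => ?_
  obtain ⟨c', hc1, hc2⟩ := exists_between hc
  obtain ⟨a', b', hb', hba', ha', hgap', hc'⟩ :=
    exists_interior_feasible hb hba ha (by linarith) (by linarith) hgap hc1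
  refine lt_of_le_of_lt ?_ hc2
  rw [div_le_iff₀ hA]
  exact EReliability_le_of_feasible (by omega) hε hε1 hb' hba' ha' (by linarith) hc'
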